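/- arXiv:math/0610069 — 11 statements merged into one kernel-verified Lean document; each statement's English description precedes it below -/
import Mathlib

section
/- Let A ⊆ B be an extension of commutative integral domains such that the localization of A at every maximal ideal is a unique factorization domain (e.g. A is a regular Noetherian domain), and such that the contraction map Spec B → Spec A, Q ↦ Q ∩ A, is surjective (e.g. A ⊆ B is an integral extension). If b ∈ B and a ∈ A is nonzero with a·b ∈ A, then b ∈ A. -/
/-- Let `A ⊆ B` be an extension of integral domains such that every localization of `A`
at a maximal ideal is a UFD, and such that `Spec B → Spec A` is surjective.
If `b ∈ B` and `a ∈ A` is nonzero with `a·b ∈ A`, then `b ∈ A`. -/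
theorem stmt0 {A B : Type*} [CommRing A] [CommRing B] [IsDomain A] [IsDomain B]
    [Algebra A B] (hinj : Function.Injective (algebraMap A B))
    (hufd : ∀ (m : Ideal A) (hm : m.IsMaximal),
      letI : m.IsPrime := hm.isPrime
      UniqueFactorizationMonoid (Localization.AtPrime m))
    (hsurj : ∀ p : Ideal A, p.IsPrime →
      ∃ q : Ideal B, q.IsPrime ∧ q.comap (algebraMap A B) = p)
    (b : B) (a : A) (ha : a ≠ 0)
    (hab : algebraMap A B a * b ∈ (algebraMap A B).range) :
    b ∈ (algebraMap A B).range := by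
  obtain ⟨c, hc⟩ := hab
  suffices h : a ∣ c by
    obtain ⟨d, rfl⟩ := h
    refine ⟨d, ?_⟩
    rw [map_mul] at hc
    exact mul_left_cancel₀ ((map_ne_zero_iff _ hinj).2 ha) hc
  let I : Ideal A := Submodule.comap (LinearMap.mulLeft A c) (Ideal.span {a})
  have hI : ∀ r, r ∈ I ↔ a ∣ c * r := fun r => Ideal.mem_span_singleton
  by_contra hac
  have hne : I ≠ ⊤ := by
    intro h
    have := (hI 1).1 (h ▸ Submodule.mem_top)
    rw [mul_one] at this
    exact hac this
  obtain ⟨m, hm, hIm⟩ := Ideal.exists_le_maximal I hne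
  haveI : m.IsPrime := hm.isPrime
  haveI : UniqueFactorizationMonoid (Localization.AtPrime m) := hufd m hm
  have hinjL : Function.Injective (algebraMap A (Localization.AtPrime m)) :=
    IsLocalization.injective _ m.primeCompl_le_nonZeroDivisors
  obtain ⟨a', c', g, hrel, hga, hgc⟩ := UniqueFactorizationMonoid.exists_reduced_factors
    (algebraMap A (Localization.AtPrime m) a) ((map_ne_zero_iff _ hinjL).2 ha)
    (algebraMap A (Localization.AtPrime m) c)
  obtain ⟨s, x, y, hx, hy⟩ : ∃ (s : m.primeCompl) (x y : A),
      algebraMap A (Localization.AtPrime m) x = a' * algebraMap A _ (s : A) ∧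
      algebraMap A (Localization.AtPrime m) y = c' * algebraMap A _ (s : A) := by
    obtain ⟨⟨x, s⟩, hx⟩ := IsLocalization.surj m.primeCompl a'
    obtain ⟨⟨y, t⟩, hy⟩ := IsLocalization.surj m.primeCompl c'
    refine ⟨s * t, x * t, y * s, ?_, ?_⟩
    · simp only [map_mul, Submonoid.coe_mul] at *
      rw [← hx]; ring
    · simp only [map_mul, Submonoid.coe_mul] at *
      rw [← hy]; ring
  have hsu : IsUnit (algebraMap A (Localization.AtPrime m) (s : A)) :=
    IsLocalization.map_units _ s
  have hay : a * y = c * x := by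
    apply hinjL
    rw [map_mul, map_mul, hx, hy, ← hga, ← hgc]; ring
  have hyb : algebraMap A B y = b * algebraMap A B x := by
    apply mul_left_cancel₀ ((map_ne_zero_iff _ hinj).2 ha)
    rw [← map_mul, hay, map_mul, hc]; ring
  have ha0 : a' ≠ 0 := by
    rintro rfl
    rw [mul_zero] at hga
    exact (map_ne_zero_iff _ hinjL).2 ha hga.symm
  by_cases hu : IsUnit a'
  · have hxs : x ∉ m := by
      intro hxm
      have h1 : IsUnit (algebraMap A (Localization.AtPrime m) x) := hx ▸ hu.mul hsu
      exact (IsLocalization.AtPrime.isUnit_to_map_iff (Localization.AtPrime m) m x).1 h1 hxm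
    exact hxs (hIm ((hI x).2 ⟨y, hay.symm⟩))
  · obtain ⟨π, hπ, hπa⟩ := WfDvdMonoid.exists_irreducible_factor hu ha0
    have hπp : Prime π := UniqueFactorizationMonoid.irreducible_iff_prime.1 hπ
    have hP : (Ideal.span {π}).IsPrime := (Ideal.span_singleton_prime hπp.ne_zero).2 hπp
    obtain ⟨q, hq, hqp⟩ := hsurj
      ((Ideal.span {π}).comap (algebraMap A (Localization.AtPrime m))) (hP.comap _)
    have hmem : ∀ z : A, algebraMap A B z ∈ q ↔ π ∣ algebraMap A (Localization.AtPrime m) z := by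
      intro z
      rw [← Ideal.mem_comap, hqp, Ideal.mem_comap, Ideal.mem_span_singleton]
    have hxq : algebraMap A B x ∈ q := (hmem x).2 (hx ▸ hπa.mul_right _)
    have hyq : algebraMap A B y ∈ q := hyb ▸ q.mul_mem_left b hxq
    have h2 := (hmem y).1 hyq
    rw [hy, hsu.dvd_mul_right] at h2
    exact hπ.not_isUnit (hrel hπa h2)
end

section
/- Let F be an intermediate field, K ⊆ F ⊆ L, and let H = {g ∈ G : g(f) = f for all f ∈ F} be the subgroup of G fixing F. Then the map L ⊗_K F → (G/H → L) sending l ⊗ f to the function gH ↦ l·g(f) (well defined since g(f) depends only on the coset gH when f ∈ F = L^H) is an isomorphism of L-algebras onto the product of [G:H] copies of L. In particular, taking F = L, the map L ⊗_K L → (G → L), l₁ ⊗ l₂ ↦ (g ↦ l₁·g(l₂)), is an isomorphism of L-algebras. -/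
open TensorProduct

/-- Let `L/K` be a finite Galois extension with galois group `G`, `F` an intermediate
field and `H = Gal(L/F)` its fixing subgroup.  Then `l ⊗ f ↦ (gH ↦ l·g(f))` is an
isomorphism of `L`-algebras `L ⊗_K F ≅ ∏_{G/H} L`.  (Taking `F = L` gives
`L ⊗_K L ≅ ∏_G L`.) -/
theorem stmt5 (K L : Type*) [Field K] [Field L] [Algebra K L]
    [FiniteDimensional K L] [IsGalois K L] (F : IntermediateField K L) :
    ∃ e : (L ⊗[K] F) ≃ₐ[L] ((L ≃ₐ[K] L) ⧸ F.fixingSubgroup → L),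
      ∀ (l : L) (f : F) (g : L ≃ₐ[K] L),
        e (l ⊗ₜ[K] f) (QuotientGroup.mk g) = l * g (f : L) := by
  classical
  have _ : Fintype ((L ≃ₐ[K] L) ⧸ F.fixingSubgroup) := Fintype.ofFinite _
  let s : (L ≃ₐ[K] L) ⧸ F.fixingSubgroup → (F →ₐ[K] L) :=
    fun q => (Quotient.out q : L ≃ₐ[K] L).toAlgHom.comp F.val
  have hs : ∀ (g : L ≃ₐ[K] L) (f : F), s (QuotientGroup.mk g) f = g (f : L) := by
    intro g f
    obtain ⟨h, hh⟩ := QuotientGroup.mk_out_eq_mul F.fixingSubgroup g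
    have h2 : (h : L ≃ₐ[K] L) (f : L) = f :=
      (IntermediateField.mem_fixingSubgroup_iff F _).1 h.2 f f.2
    change (Quotient.out (QuotientGroup.mk g : (L ≃ₐ[K] L) ⧸ F.fixingSubgroup)) (f : L) = _
    rw [hh, AlgEquiv.mul_apply, h2]
  have hinj : Function.Injective s := by
    intro p q
    induction p using QuotientGroup.induction_on with | H a =>
    induction q using QuotientGroup.induction_on with | H b =>
    intro h
    rw [QuotientGroup.eq, IntermediateField.mem_fixingSubgroup_iff]
    intro x hx
    have h3 := DFunLike.congr_fun h (⟨x, hx⟩ : F)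
    rw [hs, hs] at h3
    rw [AlgEquiv.mul_apply, ← h3]
    exact a.symm_apply_apply x
  let φ : (L ⊗[K] F) →ₐ[L] ((L ≃ₐ[K] L) ⧸ F.fixingSubgroup → L) :=
    AlgHom.pi fun q => Algebra.TensorProduct.lift (AlgHom.id L L) (s q)
      (fun _ _ => Commute.all _ _)
  have hφ : ∀ l f q, φ (l ⊗ₜ[K] f) q = l * s q f := by
    intro l f q
    simp [φ]
  have hsurj : Function.Surjective φ.toLinearMap := by
    rw [← LinearMap.range_eq_top]
    by_contra hne
    obtain ⟨c, hc, hle⟩ := Submodule.exists_le_ker_of_lt_top _ (lt_top_iff_ne_top.2 hne)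
    have hli : LinearIndependent L (fun q => ((s q : F →* L) : F → L)) :=
      (linearIndependent_monoidHom F L).comp (fun q => (s q : F →* L)) (by
        intro p q h
        apply hinj
        ext f
        exact DFunLike.congr_fun h f)
    rw [Fintype.linearIndependent_iff] at hli
    have h0 := hli (fun q => c (Pi.single q 1)) (by
      ext f
      have h1 : c (φ (1 ⊗ₜ[K] f)) = 0 := hle (LinearMap.mem_range_self φ.toLinearMap (1 ⊗ₜ[K] f))
      rw [LinearMap.pi_apply_eq_sum_univ] at h1
      simp only [hφ, one_mul, smul_eq_mul] at h1
      simp only [Finset.sum_apply, Pi.smul_apply, smul_eq_mul, Pi.zero_apply]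
      rw [← h1]
      refine Finset.sum_congr rfl fun q _ => ?_
      rw [mul_comm]
      congr 2
      ext j
      simp [Pi.single_apply, eq_comm])
    apply hc
    ext q
    simpa using h0 q
  have hdim : Module.finrank L (L ⊗[K] F) =
      Module.finrank L ((L ≃ₐ[K] L) ⧸ F.fixingSubgroup → L) := by
    rw [Module.finrank_baseChange, Module.finrank_fintype_fun_eq_card,
      IntermediateField.finrank_eq_fixingSubgroup_index, Subgroup.index, Nat.card_eq_fintype_card]
  have hi := (LinearMap.injective_iff_surjective_of_finrank_eq_finrank hdim).2 hsurj
  refine ⟨AlgEquiv.ofBijective φ ⟨hi, hsurj⟩, fun l f g => ?_⟩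
  exact (hφ l f _).trans (by rw [hs])
end

section
/- Let φ be a field automorphism of L, let H = St(φ) = {g ∈ G : g(φ(x)) = φ(x) for all x ∈ K}, and let V = L^H be the fixed field of H (a finite-dimensional K-vector space containing K). Then for every nonzero x ∈ V, the K-linear span of the set {x·φ(c) : c ∈ K} inside L equals V. Consequently, V equipped with the K-bimodule action c₁ · v · c₂ := c₁ v φ(c₂) is a simple K-bimodule (it has no nonzero proper subgroups stable under both actions). -/
theorem stmt6_key {L : Type*} [Field L] (G : Subgroup (RingAut L)) [Finite G]
    (φ : RingAut L) (v : L)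
    (hv : ∀ g ∈ G, (∀ x : L, (∀ g ∈ G, g • x = x) → g • (φ • x) = φ • x) → g • v = v) :
    v ∈ AddSubgroup.closure {y : L | ∃ c₁ : L, (∀ g ∈ G, g • c₁ = c₁) ∧
      ∃ c₂ : L, (∀ g ∈ G, g • c₂ = c₂) ∧ y = c₁ * (φ • c₂)} := by
  let F := FixedPoints.subfield G L
  have hF : ∀ x : L, x ∈ F ↔ ∀ g ∈ G, g • x = x := fun x =>
    ⟨fun h g hg => h ⟨g, hg⟩, fun h g => h g.1 g.2⟩
  let M : Submonoid L := F.toSubmonoid.map (φ : L ≃+* L).toMonoidHom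
  have hM : ∀ x : L, x ∈ M ↔ ∃ c ∈ F, φ • c = x := fun x => Iff.rfl
  let A : IntermediateField F L := IntermediateField.adjoin F (M : Set L)
  have hfin : FiniteDimensional F L := inferInstance
  have hgal : IsGalois F L := inferInstance
  have hvA : v ∈ A := by
    rw [← IsGalois.fixedField_fixingSubgroup A, IntermediateField.mem_fixedField_iff]
    intro f hf
    obtain ⟨g, rfl⟩ := FixedPoints.toAlgAut_surjective G L f
    rw [IntermediateField.mem_fixingSubgroup_iff] at hf
    refine hv g.1 g.2 fun x hx => ?_
    exact hf _ (IntermediateField.subset_adjoin F _ ((hM _).2 ⟨x, (hF x).2 hx, rfl⟩))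
  have hvA' : v ∈ Algebra.adjoin F (M : Set L) := by
    rw [← IntermediateField.adjoin_toSubalgebra]
    exact hvA
  rw [← Subalgebra.mem_toSubmodule, Algebra.adjoin_eq_span, Submonoid.closure_eq] at hvA'
  clear hvA hv
  induction hvA' using Submodule.span_induction with
  | mem x hx =>
    obtain ⟨c, hc, rfl⟩ := (hM x).1 hx
    exact AddSubgroup.subset_closure ⟨1, fun g _ => smul_one g, c, (hF c).1 hc, (one_mul _).symm⟩
  | zero => exact zero_mem _
  | add x y _ _ hx hy => exact add_mem (hx) (hy)
  | smul a x _ hx =>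
    have hx' := hx
    clear hx
    have h2 := AddSubgroup.mem_map_of_mem (AddMonoidHom.mulLeft (a : L)) hx'
    rw [AddMonoidHom.map_closure] at h2
    refine AddSubgroup.closure_mono ?_ h2
    rintro _ ⟨_, ⟨c₁, h1, c₂, h2, rfl⟩, rfl⟩
    refine ⟨a * c₁, fun g hg => ?_, c₂, h2, (mul_assoc _ _ _).symm⟩
    rw [smul_mul', h1 g hg, (hF a).1 a.2 g hg]

/-- Let `L` be a field, `G` a finite group of field automorphisms of `L` with fixed field
`K = L^G`, `φ ∈ Aut L`, `H = St(φ)` and `V = L^H`.  Then for every nonzero `x ∈ V` the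
`K`-span of `{x·φ(c) : c ∈ K}` equals `V`; consequently `V`, with the bimodule action
`c₁ · v · c₂ = c₁ v φ(c₂)`, is a simple `K`-bimodule. -/
theorem stmt6 {L : Type*} [Field L] (G : Subgroup (RingAut L)) [Finite G]
    (φ : RingAut L) (K : Set L) (hK : K = {x : L | ∀ g ∈ G, g • x = x})
    (St : Set (RingAut L))
    (hSt : St = {g : RingAut L | g ∈ G ∧ ∀ x ∈ K, g • (φ • x) = φ • x})
    (V : Set L) (hV : V = {y : L | ∀ g ∈ St, g • y = y}) :
    (∀ x ∈ V, x ≠ 0 →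
      (AddSubgroup.closure {y : L | ∃ c₁ ∈ K, ∃ c₂ ∈ K, y = c₁ * (x * (φ • c₂))} :
        Set L) = V) ∧
    (∀ W : AddSubgroup L, (W : Set L) ⊆ V →
      (∀ c ∈ K, ∀ w ∈ W, c * w ∈ W) →
      (∀ c ∈ K, ∀ w ∈ W, w * (φ • c) ∈ W) →
      (W : Set L) = {0} ∨ (W : Set L) = V) := by
  have hKm : ∀ x : L, x ∈ K ↔ ∀ g ∈ G, g • x = x := fun x => by rw [hK]; rfl
  have hSm : ∀ g, g ∈ St ↔ g ∈ G ∧ ∀ x ∈ K, g • (φ • x) = φ • x := fun x => by rw [hSt]; rfl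
  have hVm : ∀ x : L, x ∈ V ↔ ∀ g ∈ St, g • x = x := fun x => by rw [hV]; rfl
  have key : ∀ x ∈ V, x ≠ 0 →
      (AddSubgroup.closure {y : L | ∃ c₁ ∈ K, ∃ c₂ ∈ K, y = c₁ * (x * (φ • c₂))} :
        Set L) = V := by
    intro x hx hx0
    apply Set.Subset.antisymm
    · intro y hy
      rw [SetLike.mem_coe] at hy
      rw [hVm]
      intro g hg
      induction hy using AddSubgroup.closure_induction with
      | mem y hy =>
        obtain ⟨c₁, h1, c₂, h2, rfl⟩ := hy
        rw [smul_mul', smul_mul', (hKm _).1 h1 g ((hSm g).1 hg).1, (hVm _).1 hx g hg,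
          ((hSm g).1 hg).2 _ h2]
      | zero => exact smul_zero g
      | add a b _ _ ha hb => rw [smul_add, ha, hb]
      | neg a _ ha => rw [smul_neg, ha]
    · intro y hy
      have h := stmt6_key G φ (x⁻¹ * y) (fun g hg h => by
        have hg' : g ∈ St := (hSm g).2 ⟨hg, fun z hz => h z ((hKm z).1 hz)⟩
        rw [smul_mul', smul_inv'', (hVm _).1 hx g hg', (hVm _).1 hy g hg'])
      have h2 := AddSubgroup.mem_map_of_mem (AddMonoidHom.mulLeft x) h
      rw [AddMonoidHom.map_closure, AddMonoidHom.coe_mulLeft, mul_inv_cancel_left₀ hx0] at h2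
      refine AddSubgroup.closure_mono ?_ h2
      rintro _ ⟨_, ⟨c₁, h1, c₂, h2, rfl⟩, rfl⟩
      exact ⟨c₁, (hKm _).2 h1, c₂, (hKm _).2 h2, mul_left_comm _ _ _⟩
  refine ⟨key, fun W hWV hl hr => ?_⟩
  by_cases hW : ∃ w ∈ W, w ≠ 0
  · right
    obtain ⟨w, hw, hw0⟩ := hW
    refine Set.Subset.antisymm hWV ?_
    rw [← key w (hWV hw) hw0, SetLike.coe_subset_coe, AddSubgroup.closure_le]
    rintro _ ⟨c₁, h1, c₂, h2, rfl⟩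
    exact hl _ h1 _ (hr _ h2 _ hw)
  · left
    push Not at hW
    ext w
    exact ⟨fun h => hW w h, fun h => by rw [Set.mem_singleton_iff.1 h]; exact zero_mem W⟩
end

section
/- Let φ, φ' be field automorphisms of L, H = St(φ), H' = St(φ'). There exists an additive bijection e : L^H → L^{H'} satisfying e(c₁ · x · φ(c₂)) = c₁ · e(x) · φ'(c₂) for all c₁, c₂ ∈ K and x ∈ L^H (i.e. an isomorphism of the K-bimodules V(φ) and V(φ')) if and only if there exists g ∈ G with φ'(x) = g(φ(x)) for all x ∈ K (equivalently, the double cosets GφG and Gφ'G in Aut(L) coincide). -/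
/-- Let `L` be a field, `G` a finite group of field automorphisms of `L` with fixed field
`K = L^G`, and `φ, φ' ∈ Aut L` with `V = V(φ) = L^{St(φ)}` and `V' = V(φ') = L^{St(φ')}`.
There exists an additive bijection `e : V → V'` with `e(c₁ x φ(c₂)) = c₁ e(x) φ'(c₂)`
(a `K`-bimodule isomorphism `V(φ) ≅ V(φ')`) iff `φ' = g ∘ φ` on `K` for some `g ∈ G`
(iff the double cosets `GφG` and `Gφ'G` coincide). -/
theorem stmt7 {L : Type*} [Field L] (G : Subgroup (RingAut L)) [Finite G]
    (φ φ' : RingAut L) (K V V' : Set L)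
    (hK : K = {x : L | ∀ g ∈ G, g • x = x})
    (hV : V = {y : L | ∀ g ∈ G, (∀ x ∈ K, g • (φ • x) = φ • x) → g • y = y})
    (hV' : V' = {y : L | ∀ g ∈ G, (∀ x ∈ K, g • (φ' • x) = φ' • x) → g • y = y}) :
    (∃ e : L → L, Set.BijOn e V V' ∧
      (∀ x ∈ V, ∀ y ∈ V, e (x + y) = e x + e y) ∧
      (∀ c₁ ∈ K, ∀ c₂ ∈ K, ∀ x ∈ V, e (c₁ * x * (φ • c₂)) = c₁ * e x * (φ' • c₂)))
    ↔ ∃ g ∈ G, ∀ x ∈ K, φ' • x = g • (φ • x) := by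
  classical
  subst hK hV hV'
  set Kf : Subfield L := FixedPoints.subfield G L with hKf
  have memK : ∀ x : L, x ∈ Kf ↔ ∀ g ∈ G, g • x = x := by
    intro x
    constructor
    · intro h g hg
      exact h ⟨g, hg⟩
    · intro h g
      exact h g.1 g.2
  constructor
  · rintro ⟨e, hbij, hadd, hmul⟩
    set V : Set L := {y : L | ∀ g ∈ G, (∀ x ∈ {x : L | ∀ g ∈ G, g • x = x},
      g • (φ • x) = φ • x) → g • y = y} with hV
    have h1V : (1 : L) ∈ V := fun g _ _ => smul_one g
    have h0V : (0 : L) ∈ V := fun g _ _ => smul_zero g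
    have hKV : ∀ c : Kf, (c : L) ∈ V := fun c g hg _ => (memK c).1 c.2 g hg
    have hφV : ∀ c : Kf, φ • (c : L) ∈ V := fun c g hg h => h c ((memK c).1 c.2)
    have haddV : ∀ x ∈ V, ∀ y ∈ V, x + y ∈ V := fun x hx y hy g hg h => by
      rw [smul_add, hx g hg h, hy g hg h]
    have hmulV : ∀ x ∈ V, ∀ y ∈ V, x * y ∈ V := fun x hx y hy g hg h => by
      rw [smul_mul', hx g hg h, hy g hg h]
    have he0 : e 0 = 0 := by
      have := hadd 0 h0V 0 h0V
      simpa using this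
    have he1 : e 1 ≠ 0 := by
      intro h
      exact one_ne_zero (hbij.injOn h1V h0V (h.trans he0.symm))
    let f : MvPolynomial Kf Kf →ₐ[Kf] L := MvPolynomial.aeval (fun c : Kf => φ • (c : L))
    let f' : MvPolynomial Kf Kf →ₐ[Kf] L := MvPolynomial.aeval (fun c : Kf => φ' • (c : L))
    have key : ∀ p, f p ∈ V ∧ e (f p) = e 1 * f' p := by
      intro p
      induction p using MvPolynomial.induction_on with
      | C a =>
        have h := hmul a ((memK a).1 a.2) 1 (fun g _ => smul_one g) 1 h1V
        have e1 : f (MvPolynomial.C a) = (a : L) := MvPolynomial.aeval_C _ a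
        have e2 : f' (MvPolynomial.C a) = (a : L) := MvPolynomial.aeval_C _ a
        rw [e1, e2]
        refine ⟨hKV a, ?_⟩
        simpa [mul_comm] using h
      | add p q hp hq =>
        rw [map_add, map_add]
        refine ⟨haddV _ hp.1 _ hq.1, ?_⟩
        rw [hadd _ hp.1 _ hq.1, hp.2, hq.2, mul_add]
      | mul_X p i hp =>
        have e1 : f (MvPolynomial.X i) = φ • (i : L) := MvPolynomial.aeval_X _ i
        have e2 : f' (MvPolynomial.X i) = φ' • (i : L) := MvPolynomial.aeval_X _ i
        rw [map_mul, map_mul, e1, e2]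
        refine ⟨hmulV _ hp.1 _ (hφV i), ?_⟩
        have h := hmul 1 (fun g _ => smul_one g) i ((memK i).1 i.2) _ hp.1
        rw [one_mul, one_mul, hp.2] at h
        rw [h, mul_assoc]
    have hker : ∀ p, f p = 0 → f' p = 0 := by
      intro p hp
      have := (key p).2
      rw [hp, he0] at this
      exact (mul_eq_zero.1 this.symm).resolve_left he1
    have hfin : FiniteDimensional Kf L := inferInstance
    have hfield : IsField f.range := Subalgebra.isField_of_algebraic f.range
    let E : IntermediateField Kf L := f.range.toIntermediateField' hfield
    have hsurj : Function.Surjective f.rangeRestrict := f.rangeRestrict_surjective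
    let ψ : f.range →ₐ[Kf] L := AlgHom.liftOfSurjective f.rangeRestrict hsurj f' (by
      intro p hp
      apply hker
      exact congrArg Subtype.val hp)
    have hψ : ∀ p, ψ (f.rangeRestrict p) = f' p := fun p =>
      AlgHom.liftOfSurjective_apply f.rangeRestrict hsurj f' _ p
    let ψE : E →ₐ[Kf] L := ψ
    let σ : L →ₐ[Kf] L := ψE.liftNormal L
    obtain ⟨g, hg⟩ := (FixedPoints.toAlgHom_bijective G L).2 σ
    refine ⟨g.1, g.2, fun x hx => ?_⟩
    let c : Kf := ⟨x, (memK x).2 hx⟩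
    have h1 : σ (φ • x) = φ' • x := by
      have h2 := ψE.liftNormal_commutes L (f.rangeRestrict (MvPolynomial.X c))
      have e1 : f (MvPolynomial.X c) = φ • x := MvPolynomial.aeval_X _ c
      have e2 : f' (MvPolynomial.X c) = φ' • x := MvPolynomial.aeval_X _ c
      have h3 := hψ (MvPolynomial.X c)
      rw [e2] at h3
      rw [← e1, ← h3]
      exact h2
    rw [← h1, ← hg]
    rfl
  · rintro ⟨g, hg, h⟩
    refine ⟨fun x => g • x, ⟨?_, ?_, ?_⟩, fun x _ y _ => smul_add g x y, ?_⟩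
    · intro y hy k hk hk'
      have := hy (g⁻¹ * k * g) (G.mul_mem (G.mul_mem (G.inv_mem hg) hk) hg) (fun x hx => by
        rw [mul_smul, mul_smul, ← h x hx, hk' x hx, h x hx, inv_smul_smul])
      rw [mul_smul, mul_smul, inv_smul_eq_iff] at this
      exact this
    · exact (MulAction.injective g).injOn
    · intro y hy
      refine ⟨g⁻¹ • y, ?_, smul_inv_smul g y⟩
      intro k hk hk'
      have := hy (g * k * g⁻¹) (G.mul_mem (G.mul_mem hg hk) (G.inv_mem hg)) (fun x hx => by
        rw [mul_smul, mul_smul, h x hx, inv_smul_smul, hk' x hx])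
      rw [mul_smul, mul_smul] at this
      rw [eq_inv_smul_iff]
      exact this
    · intro c₁ h₁ c₂ h₂ x _
      simp only [smul_mul']
      rw [h₁ g hg, h c₂ h₂]
end

section
/- Let φ be a field automorphism of L, H = St(φ), and F = L^H (an intermediate field of L/K). Then the map Φ : L ⊗_K F → (G/H → L), l ⊗ v ↦ (gH ↦ l·g(v)), is a bijective L-linear map (L acting by multiplication on the left tensor factor and componentwise on the target), and it intertwines the twisted right K-actions: Φ((l ⊗ v)·c)(gH) = Φ(l ⊗ v)(gH) · g(φ(c)) for all c ∈ K, where the right action on the source is (l ⊗ v)·c := l ⊗ (v·φ(c)); here g(v) and g(φ(c)) depend only on the coset gH since v ∈ L^H and St(φ) fixes φ(K) pointwise. In other words, L ⊗_K V(φ) decomposes as the direct sum over gH ∈ G/H of the (L,K)-bimodules L with right K-action twisted by g∘φ. -/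
open TensorProduct

/-- Let `L/K` be a finite Galois extension with Galois group `G`, `φ` a ring automorphism
of `L`, `H = St(φ) = {g ∈ G : g ∘ φ = φ on K}` and `F = L^H = V(φ)`.  Then
`Φ : L ⊗_K F → (G/H → L)`, `l ⊗ v ↦ (gH ↦ l·g(v))`, is a bijective `L`-linear map which
intertwines the twisted right `K`-actions: on the `gH`-component the right action of
`c ∈ K` on the source (given by `(l ⊗ v)·c = l ⊗ (v·φ(c))`) corresponds to multiplication
by `g(φ(c))`.  Thus `L ⊗_K V(φ) ≅ ⊕_{gH ∈ G/H} L_{g∘φ}` as `(L,K)`-bimodules. -/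
theorem stmt8 {K L : Type*} [Field K] [Field L] [Algebra K L]
    [FiniteDimensional K L] [IsGalois K L]
    (φ : L ≃+* L) (H : Subgroup (L ≃ₐ[K] L))
    (hH : ∀ g : L ≃ₐ[K] L,
      g ∈ H ↔ ∀ x : K, g (φ (algebraMap K L x)) = φ (algebraMap K L x)) :
    ∃ e : (L ⊗[K] (IntermediateField.fixedField H)) ≃ₗ[L]
        ((L ≃ₐ[K] L) ⧸ H → L),
      (∀ (l : L) (v : IntermediateField.fixedField H) (g : L ≃ₐ[K] L),
        e (l ⊗ₜ[K] v) (QuotientGroup.mk g) = l * g (v : L)) ∧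
      (∀ (l : L) (v w : IntermediateField.fixedField H) (c : K) (g : L ≃ₐ[K] L),
        (w : L) = φ (algebraMap K L c) →
        e (l ⊗ₜ[K] (v * w)) (QuotientGroup.mk g)
          = e (l ⊗ₜ[K] v) (QuotientGroup.mk g) * g (φ (algebraMap K L c))) := by
  classical
  let F := IntermediateField.fixedField H
  let χ : ((L ≃ₐ[K] L) ⧸ H) → (F →ₐ[K] L) := fun q => (q.out : L →ₐ[K] L).comp F.val
  have hχ : ∀ (g : L ≃ₐ[K] L) (v : F), χ (QuotientGroup.mk g) v = g (v : L) := by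
    intro g v
    obtain ⟨h, hh⟩ := QuotientGroup.mk_out_eq_mul H g
    change (QuotientGroup.mk g : (L ≃ₐ[K] L) ⧸ H).out (v : L) = g (v : L)
    rw [hh, AlgEquiv.mul_apply]
    congr 1
    exact v.2 h
  have hinj : Function.Injective χ := by
    intro a b hab
    induction a using QuotientGroup.induction_on with | H a => ?_
    induction b using QuotientGroup.induction_on with | H b => ?_
    rw [QuotientGroup.eq, ← IntermediateField.fixingSubgroup_fixedField H,
      IntermediateField.mem_fixingSubgroup_iff]
    intro x hx
    have h1 := DFunLike.congr_fun hab (⟨x, hx⟩ : F)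
    rw [hχ, hχ] at h1
    rw [AlgEquiv.mul_apply]
    change a x = b x at h1
    rw [← h1]
    exact a.symm_apply_apply x
  let f : F →ₗ[K] ((L ≃ₐ[K] L) ⧸ H → L) := LinearMap.pi fun q => (χ q).toLinearMap
  let Φ : L ⊗[K] F →ₗ[L] ((L ≃ₐ[K] L) ⧸ H → L) := f.liftBaseChange L
  have hΦ : ∀ (l : L) (v : F) q, Φ (l ⊗ₜ[K] v) q = l * χ q v := by
    intro l v q
    simp [Φ, f]
  have hsurj : Function.Surjective Φ := by
    rw [← LinearMap.range_eq_top]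
    by_contra hne
    obtain ⟨t, ht0, ht⟩ := Submodule.exists_le_ker_of_lt_top _ (lt_top_iff_ne_top.2 hne)
    apply ht0
    have hli : LinearIndependent L (fun q => (((χ q : F →* L)) : F → L)) := by
      refine (linearIndependent_monoidHom F L).comp (fun q => (χ q : F →* L)) ?_
      intro a b hab
      apply hinj
      ext v
      exact DFunLike.congr_fun hab v
    rw [Fintype.linearIndependent_iff] at hli
    have hz := hli (fun q => t (Pi.single q 1)) (by
      ext v
      have h1 : t (Φ (1 ⊗ₜ[K] v)) = 0 := ht ⟨_, rfl⟩
      rw [LinearMap.pi_apply_eq_sum_univ] at h1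
      simp only [hΦ, one_mul] at h1
      rw [Finset.sum_apply, Pi.zero_apply, ← h1]
      refine Finset.sum_congr rfl fun q _ => ?_
      rw [Pi.smul_apply, smul_eq_mul, smul_eq_mul, mul_comm]
      congr 2
      ext j
      simp [Pi.single_apply, eq_comm])
    refine LinearMap.pi_ext' fun q => LinearMap.ext_ring ?_
    simpa using hz q
  have hdim : Module.finrank L (L ⊗[K] F) = Module.finrank L ((L ≃ₐ[K] L) ⧸ H → L) := by
    rw [Module.finrank_baseChange, Module.finrank_fintype_fun_eq_card, ← Nat.card_eq_fintype_card]
    have h1 := Module.finrank_mul_finrank K F L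
    rw [IntermediateField.finrank_fixedField_eq_card, ← IsGalois.card_aut_eq_finrank K L,
      Subgroup.card_eq_card_quotient_mul_card_subgroup H] at h1
    exact Nat.eq_of_mul_eq_mul_right Nat.card_pos h1
  have hbij : Function.Bijective Φ :=
    ⟨(LinearMap.injective_iff_surjective_of_finrank_eq_finrank hdim).2 hsurj, hsurj⟩
  have key : ∀ (l : L) (v : F) (g : L ≃ₐ[K] L),
      LinearEquiv.ofBijective Φ hbij (l ⊗ₜ[K] v) (QuotientGroup.mk g) = l * g (v : L) := by
    intro l v g
    rw [LinearEquiv.ofBijective_apply, hΦ, hχ]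
  refine ⟨LinearEquiv.ofBijective Φ hbij, key, ?_⟩
  intro l v w c g hw
  rw [key, key, ← hw, mul_assoc, ← map_mul]
  rfl
end

section
/- Let k be a field of characteristic 0, let K and L be field extensions of k with K ⊆ L a finite Galois extension with Galois group G acting by k-algebra automorphisms. Let V and W be k-central K-bimodules (i.e. modules over K ⊗_k K) and let π : V → W be a surjective K-bimodule homomorphism. If the induced (L,L)-bimodule homomorphism π_L : L ⊗_K V ⊗_K L → L ⊗_K W ⊗_K L (an L ⊗_k L-linear map) admits an L ⊗_k L-linear section, then π admits a K ⊗_k K-linear section. (This is the key averaging step proving that the category of L-balanced K-bimodules is semisimple.) -/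
open TensorProduct

/-- If `A → B` has an `A`-linear retraction, sections descend along base change to `B`. -/
theorem section_descends {A B V W : Type*} [CommRing A] [CommRing B] [Algebra A B]
    [AddCommGroup V] [AddCommGroup W] [Module A V] [Module A W]
    (r : B →ₗ[A] A) (hr : r 1 = 1) (π : V →ₗ[A] W)
    (s : (B ⊗[A] W) →ₗ[B] (B ⊗[A] V))
    (hs : (π.baseChange B).comp s = LinearMap.id) :
    ∃ σ : W →ₗ[A] V, π.comp σ = LinearMap.id := by
  refine ⟨(TensorProduct.lid A V).toLinearMap ∘ₗ (r.rTensor V) ∘ₗ (s.restrictScalars A) ∘ₗ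
    (TensorProduct.mk A B W 1), ?_⟩
  have key : ∀ x : B ⊗[A] V, π (TensorProduct.lid A V (r.rTensor V x)) =
      TensorProduct.lid A W (r.rTensor W (π.baseChange B x)) := by
    intro x
    induction x with
    | zero => simp
    | tmul b v => simp
    | add x y hx hy => simp only [map_add, hx, hy]
  ext w
  have h := LinearMap.congr_fun hs (1 ⊗ₜ[A] w)
  simp only [LinearMap.comp_apply, LinearMap.id_apply] at h
  simp only [LinearMap.comp_apply, LinearEquiv.coe_coe, LinearMap.restrictScalars_apply,
    TensorProduct.mk_apply, LinearMap.id_apply]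
  rw [key, h]
  simp [hr]

/-- Averaging step: let `k` be a field of characteristic `0`, `K ⊆ L` a finite Galois
extension of field extensions of `k`, `V, W` `k`-central `K`-bimodules (modules over
`K ⊗_k K`) and `π : V → W` a surjective `K`-bimodule homomorphism.  If the induced
`(L,L)`-bimodule homomorphism `π_L : L ⊗_K V ⊗_K L → L ⊗_K W ⊗_K L` (the base change of
`π` along `K ⊗_k K → L ⊗_k L`) admits an `L ⊗_k L`-linear section, then `π` admits a
`K ⊗_k K`-linear section. -/
theorem stmt9 {k K L : Type*} [Field k] [CharZero k] [Field K] [Field L]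
    [Algebra k K] [Algebra k L] [Algebra K L] [IsScalarTower k K L]
    [FiniteDimensional K L] [IsGalois K L]
    (V W : Type*) [AddCommGroup V] [AddCommGroup W]
    [Module (K ⊗[k] K) V] [Module (K ⊗[k] K) W]
    (π : V →ₗ[K ⊗[k] K] W) (hπ : Function.Surjective π) :
    letI : Algebra (K ⊗[k] K) (L ⊗[k] L) :=
      (Algebra.TensorProduct.map (IsScalarTower.toAlgHom k K L)
        (IsScalarTower.toAlgHom k K L)).toRingHom.toAlgebra
    (∃ σL : ((L ⊗[k] L) ⊗[K ⊗[k] K] W) →ₗ[L ⊗[k] L] ((L ⊗[k] L) ⊗[K ⊗[k] K] V),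
        (π.baseChange (L ⊗[k] L)).comp σL = LinearMap.id) →
    ∃ σ : W →ₗ[K ⊗[k] K] V, π.comp σ = LinearMap.id := by
  letI : Algebra (K ⊗[k] K) (L ⊗[k] L) :=
      (Algebra.TensorProduct.map (IsScalarTower.toAlgHom k K L)
        (IsScalarTower.toAlgHom k K L)).toRingHom.toAlgebra
  rintro ⟨s, hs⟩
  obtain ⟨p, hp⟩ := LinearMap.exists_leftInverse_of_injective (Algebra.linearMap K L)
    (LinearMap.ker_eq_bot.mpr (algebraMap K L).injective)
  have hp1 : p 1 = 1 := by
    have := LinearMap.congr_fun hp (1 : K)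
    simpa using this
  let r₀ : L ⊗[k] L →ₗ[k] K ⊗[k] K :=
    TensorProduct.map (p.restrictScalars k) (p.restrictScalars k)
  have hsm : ∀ (a : K ⊗[k] K) (b : L ⊗[k] L), r₀ (a • b) = a * r₀ b := by
    intro a b
    have hdef : a • b = (Algebra.TensorProduct.map (IsScalarTower.toAlgHom k K L)
        (IsScalarTower.toAlgHom k K L)) a * b := rfl
    rw [hdef]
    clear hdef
    induction a with
    | zero => simp
    | add x y hx hy => simp only [map_add, add_mul, hx, hy]
    | tmul x y =>
      induction b with
      | zero => simp
      | add u v hu hv => simp only [map_add, mul_add, hu, hv]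
      | tmul u v =>
        simp [r₀, ← Algebra.smul_def]
  let r : L ⊗[k] L →ₗ[K ⊗[k] K] K ⊗[k] K :=
    { toFun := r₀, map_add' := map_add r₀, map_smul' := hsm }
  refine section_descends r ?_ π s hs
  change r₀ (1 ⊗ₜ 1) = 1
  simp [r₀, hp1, Algebra.TensorProduct.one_def]
end

section
/- Let k be an algebraically closed field of characteristic 0, let K and L be field extensions of k with K ⊆ L a finite Galois extension with Galois group G acting by k-algebra automorphisms, and let φ, ψ be k-algebra automorphisms of L. Define an equivalence relation on G by g ∼ g' iff the double cosets G(φgψ)G and G(φg'ψ)G in Aut_k(L) coincide. Then for any choice of representatives g_c of the equivalence classes c ∈ G/∼, there is an isomorphism of K-bimodules V(φ) ⊗_K V(ψ) ≅ ⊕_{c ∈ G/∼} V(φ g_c ψ)^{⊕ m_c}, where m_c = |St(φ g_c ψ)| · |c| / (|St(φ)| · |St(ψ)|) is a positive integer and |c| is the size of the class c. -/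
open TensorProduct IntermediateField

/-- A copy of `V` regarded as a `K`-module via the ring homomorphism `f : K →+* V`:
`c • x = f c * x`.  This realizes the *twisted* (right) `K`-module structure
`x · c := x * f c` on a commutative ring `V`. -/
def TwMod {K : Type*} [Semiring K] (V : Type*) [CommRing V] (f : K →+* V) : Type _ := V

instance {K : Type*} [Semiring K] (V : Type*) [CommRing V] (f : K →+* V) :
    AddCommGroup (TwMod V f) :=
  inferInstanceAs (AddCommGroup V)

noncomputable instance {K : Type*} [Semiring K] (V : Type*) [CommRing V] (f : K →+* V) :
    Module K (TwMod V f) :=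
  Module.compHom V f

/-- The canonical identification `V → TwMod V f`. -/
def TwMod.mk {K : Type*} [Semiring K] {V : Type*} [CommRing V] (f : K →+* V) (x : V) : TwMod V f := x


theorem aux_single {R K T V : Type*} [CommRing R] [Field K] [Algebra K R] [AddCommGroup T]
    [Module R T] [Module K T] [IsScalarTower K R T] [FiniteDimensional K T]
    [Field V] [Algebra K V] (ρ : R →ₐ[K] V) (hρ : Function.Surjective ρ)
    (hT : ∀ r, ρ r = 0 → ∀ t : T, r • t = 0) :
    ∃ (m : ℕ) (e : T ≃+ (Fin m → V)), (∀ r t j, e (r • t) j = ρ r * e t j) ∧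
      m * Module.finrank K V = Module.finrank K T := by
  let F : V →+* AddMonoid.End T :=
    RingHom.liftOfRightInverse (ρ : R →+* V) (Function.surjInv hρ) (Function.rightInverse_surjInv hρ)
      ⟨Module.toAddMonoidEnd R T, fun r hr => by
        ext t
        exact hT r hr t⟩
  have hF : ∀ r, F (ρ r) = Module.toAddMonoidEnd R T r := fun r =>
    RingHom.liftOfRightInverse_comp_apply (ρ : R →+* V) (Function.surjInv hρ)
      (Function.rightInverse_surjInv hρ) _ r
  letI : Module V T := Module.compHom T F
  have hsm : ∀ (r : R) (t : T), ρ r • t = r • t := fun r t => by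
    change F (ρ r) t = _
    rw [hF]; rfl
  haveI : IsScalarTower K V T := by
    constructor
    intro c v t
    obtain ⟨r, rfl⟩ := hρ v
    rw [← map_smul, hsm, hsm, smul_assoc]
  haveI : Module.Finite V T := Module.Finite.of_restrictScalars_finite K V T
  let b := Module.finBasis V T
  refine ⟨Module.finrank V T, b.equivFun.toAddEquiv, ?_, ?_⟩
  · intro r t j
    rw [← hsm]
    simp
  · rw [mul_comm]
    exact Module.finrank_mul_finrank K V T

theorem aux_abs {R K L G ι ν T : Type*} [CommRing R] [Field K] [Algebra K R] [Field L]
    [Algebra K L] [FiniteDimensional K L] [Finite G] [Finite ι] [Finite ν] [Nonempty ν]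
    [AddCommGroup T] [Module R T]
    (ρ : G → R →ₐ[K] L) (V : ι → IntermediateField K L) (s : ι → G)
    (hV : ∀ i, (ρ (s i)).range = (V i).toSubalgebra)
    (hcov : ∀ g, ∃ i, RingHom.ker (ρ (s i)) = RingHom.ker (ρ g))
    (hinj : ∀ i j, RingHom.ker (ρ (s i)) = RingHom.ker (ρ (s j)) → i = j)
    (Θ : (ν → T) ≃+ (G → L)) (hΘ : ∀ (r : R) t g, Θ (r • t) g = ρ g r * Θ t g) :
    ∃ (m : ι → ℕ) (e : T ≃+ (∀ i, Fin (m i) → V i)),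
      (∀ i, m i * Nat.card ν * Module.finrank K (V i) =
        Nat.card {g // RingHom.ker (ρ (s i)) = RingHom.ker (ρ g)} * Module.finrank K L) ∧
      ∀ r t i j, (e (r • t) i j : L) = ρ (s i) r * (e t i j : L) := by
  classical
  haveI := Fintype.ofFinite G
  haveI := Fintype.ofFinite ι
  haveI := Fintype.ofFinite ν
  let rr : ∀ i, R →ₐ[K] V i := fun i =>
    (ρ (s i)).codRestrict (V i).toSubalgebra (fun r => by rw [← hV]; exact ⟨r, rfl⟩)
  have hrrv : ∀ i r, (rr i r : L) = ρ (s i) r := fun i r => rfl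
  have hrrs : ∀ i, Function.Surjective (rr i) := by
    rintro i ⟨v, hv⟩
    have hv' : v ∈ (V i).toSubalgebra := hv
    rw [← hV] at hv'
    obtain ⟨r, hr⟩ := hv'
    exact ⟨r, Subtype.ext hr⟩
  have hmax : ∀ i, (RingHom.ker (ρ (s i))).IsMaximal := by
    intro i
    have : RingHom.ker (ρ (s i)) = RingHom.ker (rr i) := by
      ext r
      simp only [RingHom.mem_ker]
      rw [← hrrv]
      exact_mod_cast Iff.rfl
    rw [this]
    exact RingHom.ker_isMaximal_of_surjective _ (hrrs i)
  have hcop : Pairwise fun i j => IsCoprime (RingHom.ker (ρ (s i))) (RingHom.ker (ρ (s j))) := by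
    intro i j hij
    rw [Ideal.isCoprime_iff_sup_eq]
    exact (hmax i).coprime_of_ne (hmax j) (fun h => hij (hinj i j h))
  have hε : ∀ i, ∃ r : R, ∀ j, ρ (s j) r = if j = i then 1 else 0 := by
    intro i
    obtain ⟨r, hr⟩ := Ideal.exists_forall_sub_mem_ideal hcop (fun j => if j = i then 1 else 0)
    refine ⟨r, fun j => ?_⟩
    have := hr j
    rw [RingHom.mem_ker, map_sub, sub_eq_zero] at this
    rw [this]
    split_ifs <;> simp
  choose ε hε using hε
  have hkill' : ∀ r, (∀ g, ρ g r = 0) → ∀ t : T, r • t = 0 := by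
    intro r hr t
    have : r • (fun _ : ν => t) = 0 := by
      apply Θ.injective
      funext g
      rw [hΘ, hr]; simp
    exact congrFun this (Classical.arbitrary ν)
  have hkill : ∀ r, (∀ i, ρ (s i) r = 0) → ∀ t : T, r • t = 0 := by
    intro r hr
    apply hkill'
    intro g
    obtain ⟨i, hi⟩ := hcov g
    have : r ∈ RingHom.ker (ρ (s i)) := hr i
    rwa [hi] at this
  letI : Module K T := Module.compHom T (algebraMap K R)
  haveI : IsScalarTower K R T := ⟨fun c r t => by
    rw [Algebra.smul_def, mul_smul]; rfl⟩
  have hKs : ∀ (c : K) (t : ν → T), c • t = algebraMap K R c • t := fun c t => rfl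
  let ΘK : (ν → T) ≃ₗ[K] (G → L) :=
    { Θ with
      map_smul' := fun c t => by
        funext g
        change Θ (c • t) g = c • Θ t g
        rw [hKs, hΘ, Algebra.smul_def, AlgHom.commutes] }
  have hfinν : Module.Finite K (ν → T) := Module.Finite.equiv ΘK.symm
  haveI : Module.Finite K T :=
    Module.Finite.of_surjective (LinearMap.proj (R := K) (φ := fun _ : ν => T)
      (Classical.arbitrary ν)) (LinearMap.proj_surjective _)
  -- torsion pieces
  let P : ι → Submodule R T := fun i => Submodule.torsionBySet R T (RingHom.ker (ρ (s i)))
  have hP : ∀ i t, t ∈ P i ↔ ∀ r, ρ (s i) r = 0 → r • t = 0 := by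
    intro i t
    simp only [P, Submodule.mem_torsionBySet_iff]
    constructor
    · intro h r hr; exact h ⟨r, hr⟩
    · rintro h ⟨r, hr⟩; exact h r hr
  haveI : ∀ i, Module.Finite K (P i) := fun i =>
    inferInstanceAs (Module.Finite K ((P i).restrictScalars K))
  have hsing : ∀ i, ∃ (m : ℕ) (e : P i ≃+ (Fin m → V i)),
      (∀ r t j, e (r • t) j = rr i r * e t j) ∧
      m * Module.finrank K (V i) = Module.finrank K (P i) := by
    intro i
    refine aux_single (rr i) (hrrs i) ?_
    intro r hr t
    apply Subtype.ext
    exact (hP i t).1 t.2 r (by rw [← hrrv, hr]; rfl)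
  choose m e he hm using hsing
  have hmem : ∀ i (t : T), ε i • t ∈ P i := by
    intro i t
    rw [hP]
    intro r hr
    rw [← mul_smul]
    apply hkill
    intro j
    rw [map_mul, hε]
    split_ifs with h
    · subst h; simp [hr]
    · simp
  have hPε : ∀ i j (t : P i), ε j • (t : T) = if j = i then (t : T) else 0 := by
    intro i j t
    split_ifs with h
    · subst h
      rw [← sub_eq_zero]
      have := (hP j t).1 t.2 (ε j - 1) (by rw [map_sub, hε]; simp)
      rwa [sub_smul, one_smul] at this
    · exact (hP i t).1 t.2 _ (by rw [hε]; simp [Ne.symm h])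
  have hsum : ∀ t : T, ∑ i, ε i • t = t := by
    intro t
    rw [← Finset.sum_smul, ← sub_eq_zero]
    have := hkill (∑ i, ε i - 1) (fun j => by
      rw [map_sub, map_sum]; simp [hε]) t
    rwa [sub_smul, one_smul] at this
  let D : T ≃+ (∀ i, P i) :=
    { toFun := fun t i => ⟨ε i • t, hmem i t⟩
      invFun := fun f => ∑ i, (f i : T)
      left_inv := fun t => hsum t
      right_inv := fun f => by
        funext i
        apply Subtype.ext
        change ε i • ∑ j, (f j : T) = f i
        rw [Finset.smul_sum]
        simp [hPε]
      map_add' := fun t t' => by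
        funext i
        apply Subtype.ext
        exact smul_add _ _ _ }
  refine ⟨m, D.trans (AddEquiv.piCongrRight e), ?_, ?_⟩
  · intro i
    -- dimension count
    let C := {g // RingHom.ker (ρ (s i)) = RingHom.ker (ρ g)}
    let f : (ν → P i) →ₗ[K] (C → L) :=
      { toFun := fun t g => Θ (fun u => (t u : T)) g
        map_add' := fun t t' => by
          funext g
          change Θ ((fun u => (t u : T)) + (fun u => (t' u : T))) g = _
          rw [map_add]; rfl
        map_smul' := fun c t => by
          funext g
          change ΘK (c • (fun u => (t u : T))) g = _
          rw [map_smul]; rfl }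
    have hf : Function.Bijective f := by
      constructor
      · rw [injective_iff_map_eq_zero]
        intro t ht
        have h0 : (fun u => (t u : T)) = 0 := by
          apply Θ.injective
          rw [map_zero]
          funext g
          by_cases hg : RingHom.ker (ρ (s i)) = RingHom.ker (ρ g)
          · exact congrFun ht ⟨g, hg⟩
          · obtain ⟨j, hj⟩ := hcov g
            have hij : i ≠ j := by rintro rfl; exact hg hj
            have h1 : ρ g (1 - ε j) = 0 := by
              have : 1 - ε j ∈ RingHom.ker (ρ (s j)) := by
                rw [RingHom.mem_ker, map_sub, hε]; simp
              rwa [hj] at this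
            have h2 : ε j • (fun u => (t u : T)) = 0 := by
              funext u
              change ε j • (t u : T) = 0
              rw [hPε, if_neg hij.symm]
            have h3 := hΘ (ε j) (fun u => (t u : T)) g
            rw [h2, map_zero] at h3
            rw [map_sub, sub_eq_zero, map_one] at h1
            rw [← h1, one_mul] at h3
            exact h3.symm
        funext u
        exact Subtype.ext (congrFun h0 u)
      · intro y
        let y' : G → L := fun g =>
          if h : RingHom.ker (ρ (s i)) = RingHom.ker (ρ g) then y ⟨g, h⟩ else 0
        have hy : ∀ u, Θ.symm y' u ∈ P i := by
          intro u
          rw [hP]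
          intro r hr
          have : r • Θ.symm y' = 0 := by
            apply Θ.injective
            funext g
            rw [hΘ, Θ.apply_symm_apply, map_zero]
            by_cases h : RingHom.ker (ρ (s i)) = RingHom.ker (ρ g)
            · have : r ∈ RingHom.ker (ρ (s i)) := hr
              rw [h] at this
              rw [RingHom.mem_ker] at this
              simp [this]
            · simp [y', h]
          exact congrFun this u
        refine ⟨fun u => ⟨Θ.symm y' u, hy u⟩, ?_⟩
        funext g
        change Θ (Θ.symm y') g = _
        rw [Θ.apply_symm_apply]
        simp only [y']
        rw [dif_pos g.2]
    have hd := (LinearEquiv.ofBijective f hf).finrank_eq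
    rw [Module.finrank_pi_fintype, Module.finrank_pi_fintype] at hd
    simp only [Finset.sum_const, Finset.card_univ, smul_eq_mul] at hd
    rw [Nat.card_eq_fintype_card, Nat.card_eq_fintype_card, mul_right_comm, hm, mul_comm, hd]
  · intro r t i j
    change ((e i (D (r • t) i)) j : L) = ρ (s i) r * ((e i (D t i)) j : L)
    have : D (r • t) i = r • D t i := by
      apply Subtype.ext
      exact smul_comm _ _ _
    rw [this, he]
    rfl

/-- `K ⊗ K → L`, `c₁ ⊗ c₂ ↦ c₁ τ(c₂)`. -/
noncomputable def rhoHom {K L : Type*} [Field K] [Field L] [Algebra K L] (τ : L →+* L) :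
    K ⊗[ℤ] K →ₐ[K] L :=
  Algebra.TensorProduct.lift (Algebra.ofId K L) (RingHom.toIntAlgHom (τ.comp (algebraMap K L)))
    (fun _ _ => Commute.all _ _)

theorem rhoHom_tmul {K L : Type*} [Field K] [Field L] [Algebra K L] (τ : L →+* L) (c d : K) :
    rhoHom τ (c ⊗ₜ[ℤ] d) = algebraMap K L c * τ (algebraMap K L d) := by
  simp [rhoHom, Algebra.ofId_apply]

theorem rhoHom_range {K L : Type*} [Field K] [Field L] [Algebra K L]
    [FiniteDimensional K L] [IsGalois K L] (τ : L →+* L) (S : Subgroup (L ≃ₐ[K] L))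
    (hS : ∀ g, g ∈ S ↔ ∀ x : K, g (τ (algebraMap K L x)) = τ (algebraMap K L x)) :
    (rhoHom (K := K) τ).range = (fixedField S).toSubalgebra := by
  let E : IntermediateField K L := Subalgebra.toIntermediateField (rhoHom (K := K) τ).range
    (fun x hx => Subalgebra.inv_mem_of_algebraic _ (x := ⟨x, hx⟩)
      (Algebra.IsAlgebraic.isAlgebraic x))
  have hE : E.toSubalgebra = (rhoHom (K := K) τ).range := rfl
  have : S = E.fixingSubgroup := by
    ext g
    rw [hS, IntermediateField.mem_fixingSubgroup_iff]
    constructor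
    · rintro h x ⟨r, rfl⟩
      change g (rhoHom τ r) = rhoHom τ r
      induction r using TensorProduct.induction_on with
      | zero => simp
      | tmul c d => rw [rhoHom_tmul, map_mul, AlgEquiv.commutes, h]
      | add a b ha hb => rw [map_add, map_add, ha, hb]
    · intro h x
      apply h
      exact ⟨1 ⊗ₜ x, by change rhoHom τ _ = _; rw [rhoHom_tmul]; simp⟩
  rw [← hE, this, IsGalois.fixedField_fixingSubgroup]

theorem rhoHom_ker {k K L : Type*} [Field k] [Field K] [Field L] [Algebra k K] [Algebra k L]
    [Algebra K L] [IsScalarTower k K L]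
    [FiniteDimensional K L] [IsGalois K L] (τ τ' : L ≃ₐ[k] L) :
    RingHom.ker (rhoHom (K := K) (τ : L →+* L)) = RingHom.ker (rhoHom (K := K) (τ' : L →+* L)) ↔
      ∃ a b : L ≃ₐ[K] L, τ' = (b.restrictScalars k).trans (τ.trans (a.restrictScalars k)) := by
  constructor
  · intro h
    let E : IntermediateField K L := Subalgebra.toIntermediateField
      (rhoHom (K := K) (τ : L →+* L)).range
      (fun x hx => Subalgebra.inv_mem_of_algebraic _ (x := ⟨x, hx⟩)
        (Algebra.IsAlgebraic.isAlgebraic x))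
    let ρ : K ⊗[ℤ] K →ₐ[K] E := (rhoHom (K := K) (τ : L →+* L)).rangeRestrict
    have hρ : Function.Surjective ρ := (rhoHom (K := K) (τ : L →+* L)).rangeRestrict_surjective
    have hker : ∀ r ∈ RingHom.ker ρ, rhoHom (K := K) (τ' : L →+* L) r = 0 := by
      intro r hr
      have : r ∈ RingHom.ker (rhoHom (K := K) (τ : L →+* L)) := by
        rw [RingHom.mem_ker] at hr ⊢
        exact congrArg Subtype.val hr
      rwa [h] at this
    let χ : E →ₐ[K] L := (Ideal.Quotient.liftₐ (RingHom.ker ρ) (rhoHom (K := K) (τ' : L →+* L))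
      hker).comp (Ideal.quotientKerAlgEquivOfSurjective hρ).symm.toAlgHom
    have hχ : ∀ r, χ (ρ r) = rhoHom (K := K) (τ' : L →+* L) r := by
      intro r
      have : (Ideal.quotientKerAlgEquivOfSurjective hρ).symm (ρ r) = Ideal.Quotient.mk _ r := by
        rw [AlgEquiv.symm_apply_eq]
        rfl
      change Ideal.Quotient.liftₐ (RingHom.ker ρ) (rhoHom (K := K) (τ' : L →+* L))
        hker ((Ideal.quotientKerAlgEquivOfSurjective hρ).symm (ρ r)) = _
      rw [this]
      rfl
    let a : L ≃ₐ[K] L := AlgEquiv.ofBijective (χ.liftNormal L) (AlgHom.normal_bijective K L L _)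
    have ha : ∀ c : K, a (τ (algebraMap K L c)) = τ' (algebraMap K L c) := by
      intro c
      have h1 : (ρ (1 ⊗ₜ c) : L) = τ (algebraMap K L c) := by
        change rhoHom (K := K) (τ : L →+* L) _ = _
        rw [rhoHom_tmul]; simp
      have h2 := hχ (1 ⊗ₜ c)
      rw [rhoHom_tmul, map_one, one_mul] at h2
      have h3 := χ.liftNormal_commutes L (ρ (1 ⊗ₜ c))
      rw [h2] at h3
      change χ.liftNormal L (ρ (1 ⊗ₜ c) : L) = _ at h3
      rw [h1] at h3
      exact h3
    let b : L ≃ₐ[K] L := AlgEquiv.ofRingEquiv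
      (f := ((τ'.trans (a.restrictScalars k).symm).trans τ.symm).toRingEquiv) (by
        intro c
        change τ.symm (a.symm (τ' (algebraMap K L c))) = _
        rw [← ha]; simp)
    refine ⟨a, b, ?_⟩
    ext x
    change τ' x = a (τ (τ.symm (a.symm (τ' x))))
    simp
  · rintro ⟨a, b, rfl⟩
    have : ∀ r : K ⊗[ℤ] K, rhoHom (K := K)
        (((b.restrictScalars k).trans (τ.trans (a.restrictScalars k)) : L ≃ₐ[k] L) : L →+* L) r =
        a (rhoHom (K := K) (τ : L →+* L) r) := by
      intro r
      induction r using TensorProduct.induction_on with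
      | zero => simp
      | tmul c d =>
        rw [rhoHom_tmul, rhoHom_tmul, map_mul, AlgEquiv.commutes]
        congr 1
        change a (τ (b _)) = a (τ _)
        rw [AlgEquiv.commutes]
      | add x y hx hy => rw [map_add, map_add, hx, hy, map_add]
    ext r
    rw [RingHom.mem_ker, RingHom.mem_ker, this]
    simp
theorem dedekind_bij {K L W : Type*} [Field K] [Field L] [Algebra K L]
    [FiniteDimensional K L] [IsGalois K L] [Fintype W] (φ : L →+* L) (ω : Module.Basis W K L) :
    Function.Bijective (fun (x : W → L) (g : L ≃ₐ[K] L) => ∑ w, x w * φ (g (ω w))) := by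
  classical
  have hcard : Fintype.card W = Fintype.card (L ≃ₐ[K] L) := by
    rw [← Module.finrank_eq_card_basis ω, ← Nat.card_eq_fintype_card, IsGalois.card_aut_eq_finrank]
  let f : (W → L) →ₗ[L] ((L ≃ₐ[K] L) → L) :=
    { toFun := fun x g => ∑ w, x w * φ (g (ω w))
      map_add' := fun x y => by
        funext g
        simp [add_mul, Finset.sum_add_distrib]
      map_smul' := fun c x => by
        funext g
        simp [Finset.mul_sum, mul_assoc] }
  have hdim : Module.finrank L (W → L) = Module.finrank L ((L ≃ₐ[K] L) → L) := by
    simp [hcard]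
  have hsurj : Function.Surjective f := by
    rw [← LinearMap.range_eq_top]
    by_contra hne
    obtain ⟨l, hl0, hl⟩ := Submodule.exists_le_ker_of_lt_top _ (lt_top_iff_ne_top.2 hne)
    apply hl0
    let c : (L ≃ₐ[K] L) → L := fun g => l (Pi.single g 1)
    have hlc : ∀ y, l y = ∑ g, c g * y g := by
      intro y
      conv_lhs => rw [pi_eq_sum_univ' y]
      rw [map_sum]
      refine Finset.sum_congr rfl fun g _ => ?_
      rw [map_smul, smul_eq_mul, mul_comm]
    have h1 : ∀ w, ∑ g, c g * φ (g (ω w)) = 0 := by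
      intro w
      have := hl ⟨Pi.single w 1, rfl⟩
      rw [LinearMap.mem_ker, hlc] at this
      simpa [f, Pi.single_apply] using this
    have h2 : ∀ y : L, ∑ g, c g * φ (g y) = 0 := by
      intro y
      rw [← ω.sum_repr y]
      simp only [map_sum, Algebra.smul_def, map_mul, AlgEquiv.commutes, Finset.mul_sum]
      rw [Finset.sum_comm]
      refine Finset.sum_eq_zero fun w _ => ?_
      have := congrArg (fun z => φ (algebraMap K L (ω.repr y w)) * z) (h1 w)
      simp only [Finset.mul_sum, mul_zero] at this
      rw [← this]
      exact Finset.sum_congr rfl fun g _ => by ring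
    have hli := (linearIndependent_monoidHom L L).comp
      (fun g : L ≃ₐ[K] L => ((φ.comp (g : L →+* L) : L →+* L) : L →* L)) (by
        intro g g' h
        ext x
        exact φ.injective (DFunLike.congr_fun h x))
    rw [Fintype.linearIndependent_iff] at hli
    have hc := hli c (by
      funext y
      simpa using h2 y)
    ext g
    simpa [c] using hc g
  exact ⟨(LinearMap.injective_iff_surjective_of_finrank_eq_finrank hdim).2 hsurj, hsurj⟩

/-- The inclusion `TwMod F f → L`. -/
noncomputable def twVal {K L : Type*} [Field K] [Field L] [Algebra K L] (F : IntermediateField K L)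
    (f : K →+* F) : TwMod F f →+ L :=
  (F.val : F →ₐ[K] L).toRingHom.toAddMonoidHom

theorem twVal_smul {K L : Type*} [Field K] [Field L] [Algebra K L] (F : IntermediateField K L)
    (f : K →+* F) (c : K) (x : TwMod F f) : twVal F f (c • x) = (f c : L) * twVal F f x := rfl

/-- Multiplication by `F` on `TwMod F f`. -/
noncomputable def twMul {K L : Type*} [Field K] [Field L] [Algebra K L] (F : IntermediateField K L)
    (f : K →+* F) : F →+* Module.End K (TwMod F f) where
  toFun a :=
    { toFun := fun x => (show F from a * (show F from x))
      map_add' := fun x y => mul_add (a : F) (show F from x) (show F from y)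
      map_smul' := fun c x => mul_left_comm (a : F) (f c) (show F from x) }
  map_one' := LinearMap.ext fun x => one_mul (show F from x)
  map_mul' a b := LinearMap.ext fun x => mul_assoc a b (show F from x)
  map_zero' := LinearMap.ext fun x => zero_mul (show F from x)
  map_add' a b := LinearMap.ext fun x => add_mul a b (show F from x)

theorem twMul_val {K L : Type*} [Field K] [Field L] [Algebra K L] (F : IntermediateField K L)
    (f : K →+* F) (a : F) (x : TwMod F f) : twVal F f (twMul F f a x) = (a : L) * twVal F f x := rfl

/-- The bimodule structure of the tensor product. -/
noncomputable def bimodHom {K L : Type*} [Field K] [Field L] [Algebra K L]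
    (F E : IntermediateField K L) (f : K →+* F) (h : K →+* E) :
    K ⊗[ℤ] K →+* Module.End K (TwMod F f ⊗[K] E) :=
  (Algebra.TensorProduct.lift
    (RingHom.toIntAlgHom ((Module.End.rTensorAlgHom K (TwMod F f) E).toRingHom.comp
      ((twMul F f).comp (algebraMap K F))))
    (RingHom.toIntAlgHom ((Module.End.lTensorAlgHom K E (TwMod F f)).toRingHom.comp
      ((Algebra.lmul K E).toRingHom.comp h)))
    (fun x y => by
      apply TensorProduct.ext'
      intro a b
      rfl)).toRingHom

theorem bimodHom_tmul {K L : Type*} [Field K] [Field L] [Algebra K L]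
    (F E : IntermediateField K L) (f : K →+* F) (h : K →+* E) (c d : K) (x : TwMod F f) (y : E) :
    bimodHom F E f h (c ⊗ₜ d) (x ⊗ₜ y) = (twMul F f (algebraMap K F c) x) ⊗ₜ (h d * y) := by
  simp only [bimodHom, AlgHom.toRingHom_eq_coe, RingHom.coe_coe, Algebra.TensorProduct.lift_tmul]
  rfl

/-- `x ⊗ y ↦ (β x φ(g(γ y)))_g`. -/
noncomputable def thetaHom {K L : Type*} [Field K] [Field L] [Algebra K L]
    (F E : IntermediateField K L) (f : K →+* F) (φ : L →+* L)
    (hf : ∀ c, (f c : L) = φ (algebraMap K L c)) (β γ : L) :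
    TwMod F f ⊗[K] E →+ ((L ≃ₐ[K] L) → L) :=
  TensorProduct.liftAddHom
    (AddMonoidHom.mk' (fun x => AddMonoidHom.mk'
      (fun (y : E) (g : L ≃ₐ[K] L) => β * twVal F f x * φ (g (γ * (y : L))))
      (by intro a b; funext g; simp [mul_add]))
      (by intro a b; ext y g; simp [mul_add, add_mul]))
    (by
      intro r m n
      funext g
      simp only [AddMonoidHom.mk'_apply, twVal_smul, hf, Algebra.smul_def, MulMemClass.coe_mul,
        map_mul, IntermediateField.algebraMap_apply]
      have : g ((algebraMap K E r : E) : L) = algebraMap K L r := g.commutes r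
      rw [this]
      ring)

theorem thetaHom_tmul {K L : Type*} [Field K] [Field L] [Algebra K L]
    (F E : IntermediateField K L) (f : K →+* F) (φ : L →+* L)
    (hf : ∀ c, (f c : L) = φ (algebraMap K L c)) (β γ : L) (x : TwMod F f) (y : E)
    (g : L ≃ₐ[K] L) :
    thetaHom F E f φ hf β γ (x ⊗ₜ y) g = β * twVal F f x * φ (g (γ * (y : L))) := rfl

theorem thetaHom_smul {K L : Type*} [Field K] [Field L] [Algebra K L]
    (F E : IntermediateField K L) (f : K →+* F) (h : K →+* E) (φ ψ : L →+* L)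
    (hf : ∀ c, (f c : L) = φ (algebraMap K L c))
    (hh : ∀ c, (h c : L) = ψ (algebraMap K L c)) (β γ : L) (r : K ⊗[ℤ] K)
    (t : TwMod F f ⊗[K] E) (g : L ≃ₐ[K] L) :
    thetaHom F E f φ hf β γ (bimodHom F E f h r t) g =
      rhoHom (φ.comp ((g : L →+* L).comp ψ)) r * thetaHom F E f φ hf β γ t g := by
  induction r using TensorProduct.induction_on with
  | zero => simp
  | add a b ha hb =>
    rw [map_add, LinearMap.add_apply, map_add, Pi.add_apply, ha, hb, map_add, add_mul]
  | tmul c d =>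
    induction t using TensorProduct.induction_on with
    | zero => simp
    | add a b ha hb => rw [map_add, map_add, Pi.add_apply, ha, hb, map_add, Pi.add_apply, mul_add]
    | tmul x y =>
      rw [bimodHom_tmul, thetaHom_tmul, thetaHom_tmul, rhoHom_tmul, twMul_val]
      simp only [MulMemClass.coe_mul, hh, map_mul, RingHom.comp_apply, RingHom.coe_coe]
      have : ((algebraMap K F c : F) : L) = algebraMap K L c := rfl
      rw [this]
      ring

theorem exists_theta {K L : Type*} [Field K] [Field L] [Algebra K L]
    [FiniteDimensional K L] [IsGalois K L]
    (F E : IntermediateField K L) (f : K →+* F) (h : K →+* E) (φ ψ : L →+* L)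
    (hf : ∀ c, (f c : L) = φ (algebraMap K L c))
    (hh : ∀ c, (h c : L) = ψ (algebraMap K L c)) :
    ∃ Θ : (Fin (Module.finrank F L) × Fin (Module.finrank E L) → TwMod F f ⊗[K] E) ≃+
        ((L ≃ₐ[K] L) → L),
      ∀ (r : K ⊗[ℤ] K) t g, Θ (fun u => bimodHom F E f h r (t u)) g =
        rhoHom (φ.comp ((g : L →+* L).comp ψ)) r * Θ t g := by
  classical
  let β := Module.finBasis F L
  let γ := Module.finBasis E L
  let b := Module.finBasis K E
  let ω := b.smulTower γ
  let Θ₀ : (Fin (Module.finrank F L) × Fin (Module.finrank E L) → TwMod F f ⊗[K] E) →+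
      ((L ≃ₐ[K] L) → L) :=
    ∑ u, (thetaHom F E f φ hf (β u.1) (γ u.2)).comp (Pi.evalAddMonoidHom _ u)
  have hΘ₀ : ∀ t g, Θ₀ t g = ∑ u, thetaHom F E f φ hf (β u.1) (γ u.2) (t u) g := by
    intro t g
    simp [Θ₀, AddMonoidHom.finsetSum_apply, Finset.sum_apply]
  have hbij := dedekind_bij φ ω
  -- explicit formula
  have hform : ∀ (x : Fin (Module.finrank F L) × Fin (Module.finrank E L) →
        Fin (Module.finrank K E) → F) g,
      Θ₀ (fun u => ∑ j, TwMod.mk f (x u j) ⊗ₜ b j) g =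
      ∑ w : Fin (Module.finrank K E) × Fin (Module.finrank E L),
        (∑ u, x (u, w.2) w.1 • β u) * φ (g (ω w)) := by
    intro x g
    rw [hΘ₀, Fintype.sum_prod_type, Fintype.sum_prod_type]
    simp only [map_sum, Finset.sum_apply, thetaHom_tmul, Finset.sum_mul]
    rw [Finset.sum_comm]
    conv_rhs => rw [Finset.sum_comm]
    refine Finset.sum_congr rfl fun v _ => ?_
    rw [Finset.sum_comm]
    refine Finset.sum_congr rfl fun j _ => Finset.sum_congr rfl fun u _ => ?_
    have h1 : twVal F f (TwMod.mk f (x (u, v) j)) = (x (u, v) j : L) := rfl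
    have h2 : ω (j, v) = γ v * (b j : L) := by
      rw [Module.Basis.smulTower_apply, mul_comm]; rfl
    rw [h1, h2]
    change _ = ((x (u, v) j : L) * β u) * _
    ring
  have hrepr : ∀ t : Fin (Module.finrank F L) × Fin (Module.finrank E L) → TwMod F f ⊗[K] E,
      ∃ x : Fin (Module.finrank F L) × Fin (Module.finrank E L) →
        Fin (Module.finrank K E) → F, t = fun u => ∑ j, TwMod.mk f (x u j) ⊗ₜ b j := by
    intro t
    have : ∀ u, ∃ x : Fin (Module.finrank K E) → F, t u = ∑ j, TwMod.mk f (x j) ⊗ₜ b j := by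
      intro u
      obtain ⟨c, hc⟩ := TensorProduct.eq_repr_basis_right b (t u)
      refine ⟨fun j => (show F from c j), ?_⟩
      rw [← hc, Finsupp.sum_fintype _ _ (by simp)]
      rfl
    choose x hx using this
    exact ⟨x, funext hx⟩
  have hB : Function.Bijective Θ₀ := by
    constructor
    · rw [injective_iff_map_eq_zero]
      intro t ht
      obtain ⟨x, rfl⟩ := hrepr t
      have h0 : (fun w : Fin (Module.finrank K E) × Fin (Module.finrank E L) =>
          ∑ u, x (u, w.2) w.1 • β u) = 0 := by
        apply hbij.1
        funext g
        have := congrFun ht g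
        rw [hform] at this
        simpa using this
      have hx : ∀ u v j, x (u, v) j = 0 := by
        intro u v j
        exact Fintype.linearIndependent_iff.1 β.linearIndependent (fun u => x (u, v) j)
          (congrFun h0 (j, v)) u
      funext u
      refine Finset.sum_eq_zero fun j _ => ?_
      rw [hx u.1 u.2 j]
      exact TensorProduct.zero_tmul _ _
    · intro y
      obtain ⟨z, hz⟩ := hbij.2 y
      refine ⟨fun u => ∑ j, TwMod.mk f (β.repr (z (j, u.2)) u.1) ⊗ₜ b j, ?_⟩
      funext g
      rw [hform (fun u j => β.repr (z (j, u.2)) u.1)]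
      rw [← hz]
      refine Finset.sum_congr rfl fun w _ => ?_
      simp only [Prod.mk.eta, β.sum_repr]
  refine ⟨AddEquiv.ofBijective Θ₀ hB, ?_⟩
  intro r t g
  change Θ₀ _ g = _ * Θ₀ t g
  rw [hΘ₀, hΘ₀, Finset.mul_sum]
  exact Finset.sum_congr rfl fun u _ => thetaHom_smul F E f h φ ψ hf hh _ _ r (t u) g
/-- Tensor product decomposition of products of simple balanced bimodules:
`V(φ) ⊗_K V(ψ) ≅ ⊕_{c ∈ G/∼} V(φ g_c ψ)^{m_c}` where `g ∼ g'` iff the double cosets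
`G(φgψ)G` and `G(φg'ψ)G` coincide, and
`m_c = |St(φ g_c ψ)|·|c| / (|St(φ)|·|St(ψ)|)` is a positive integer.

Here `k` is an algebraically closed field of characteristic `0`, `K ⊆ L` a finite Galois
extension of field extensions of `k` with Galois group `G = Gal(L/K)` acting `k`-linearly,
`φ, ψ` are `k`-algebra automorphisms of `L`, `St τ = {g ∈ G : g ∘ τ = τ on K}`,
`V(τ) = L^{St τ}` with bimodule action `c₁ · x · c₂ = c₁ x τ(c₂)`; the tensor product is
taken over `K` using the (twisted) right action of `V(φ)` and the left action of `V(ψ)`,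
`rep` is any choice of representatives of the equivalence classes, and the isomorphism is
an isomorphism of `K`-bimodules (an additive bijection intertwining the outer left and
right `K`-actions, expressed on pure tensors). -/
theorem stmt10 {k K L : Type*} [Field k] [IsAlgClosed k] [CharZero k]
    [Field K] [Field L] [Algebra k K] [Algebra k L] [Algebra K L] [IsScalarTower k K L]
    [FiniteDimensional K L] [IsGalois K L]
    (φ ψ : L ≃ₐ[k] L)
    (St : (L ≃ₐ[k] L) → Subgroup (L ≃ₐ[K] L))
    (hSt : ∀ (τ : L ≃ₐ[k] L) (g : L ≃ₐ[K] L),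
      g ∈ St τ ↔ ∀ x : K, g (τ (algebraMap K L x)) = τ (algebraMap K L x))
    (comp : (L ≃ₐ[K] L) → (L ≃ₐ[k] L))
    (hcomp : ∀ g : L ≃ₐ[K] L,
      comp g = ψ.trans ((g.restrictScalars k).trans φ))
    (rel : (L ≃ₐ[K] L) → (L ≃ₐ[K] L) → Prop)
    (hrel : ∀ g g' : L ≃ₐ[K] L, rel g g' ↔ ∃ a b : L ≃ₐ[K] L,
      comp g' = (b.restrictScalars k).trans ((comp g).trans (a.restrictScalars k)))
    (rep : (L ≃ₐ[K] L) → (L ≃ₐ[K] L))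
    (hrep : ∀ g, rel g (rep g))
    (hrep' : ∀ g g', rel g g' ↔ rep g = rep g')
    (φK : K →+* ↥(fixedField (St φ)))
    (hφK : ∀ c : K, (φK c : L) = φ (algebraMap K L c))
    (ψK : K →+* ↥(fixedField (St ψ)))
    (hψK : ∀ c : K, (ψK c : L) = ψ (algebraMap K L c)) :
    ∃ (m : {g : L ≃ₐ[K] L // rep g = g} → ℕ)
      (e : (TwMod ↥(fixedField (St φ)) φK ⊗[K] ↥(fixedField (St ψ))) ≃+
        (∀ i : {g : L ≃ₐ[K] L // rep g = g},
          Fin (m i) → ↥(fixedField (St (comp (i : L ≃ₐ[K] L)))))),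
      (∀ i : {g : L ≃ₐ[K] L // rep g = g}, 0 < m i ∧
        m i * (Nat.card (St φ) * Nat.card (St ψ))
          = Nat.card (St (comp (i : L ≃ₐ[K] L)))
            * Nat.card {g : L ≃ₐ[K] L // rel (i : L ≃ₐ[K] L) g}) ∧
      (∀ (c : K) (x : ↥(fixedField (St φ))) (y : ↥(fixedField (St ψ)))
        (i : {g : L ≃ₐ[K] L // rep g = g}) (j : Fin (m i)),
        (e (TwMod.mk φK (algebraMap K ↥(fixedField (St φ)) c * x) ⊗ₜ[K] y) i j : L)
          = algebraMap K L c * (e (TwMod.mk φK x ⊗ₜ[K] y) i j : L)) ∧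
      (∀ (c : K) (x : ↥(fixedField (St φ))) (y : ↥(fixedField (St ψ)))
        (i : {g : L ≃ₐ[K] L // rep g = g}) (j : Fin (m i)),
        (e (TwMod.mk φK x ⊗ₜ[K] (y * ψK c)) i j : L)
          = (e (TwMod.mk φK x ⊗ₜ[K] y) i j : L)
            * (comp (i : L ≃ₐ[K] L)) (algebraMap K L c)) := by

  classical
  let ρ : (L ≃ₐ[K] L) → K ⊗[ℤ] K →ₐ[K] L := fun g => rhoHom ((comp g : L ≃ₐ[k] L) : L →+* L)
  have hρ : ∀ g : L ≃ₐ[K] L, rhoHom ((φ : L →+* L).comp ((g : L →+* L).comp (ψ : L →+* L))) = ρ g := by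
    intro g
    have : (φ : L →+* L).comp ((g : L →+* L).comp (ψ : L →+* L)) =
        ((comp g : L ≃ₐ[k] L) : L →+* L) := by
      rw [hcomp]; rfl
    rw [this]
  have hker : ∀ g g', RingHom.ker (ρ g) = RingHom.ker (ρ g') ↔ rel g g' := by
    intro g g'
    rw [hrel]
    exact rhoHom_ker (comp g) (comp g')
  obtain ⟨Θ, hΘ⟩ := exists_theta (fixedField (St φ)) (fixedField (St ψ)) φK ψK
    (φ : L →+* L) (ψ : L →+* L) hφK hψK
  letI : Module (K ⊗[ℤ] K) (TwMod ↥(fixedField (St φ)) φK ⊗[K] ↥(fixedField (St ψ))) :=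
    Module.compHom _ (bimodHom (fixedField (St φ)) (fixedField (St ψ)) φK ψK)
  have hsm : ∀ (r : K ⊗[ℤ] K)
      (t : TwMod ↥(fixedField (St φ)) φK ⊗[K] ↥(fixedField (St ψ))),
      r • t = bimodHom (fixedField (St φ)) (fixedField (St ψ)) φK ψK r t := fun r t => rfl
  haveI : NeZero (Module.finrank (fixedField (St φ)) L) := ⟨Module.finrank_pos.ne'⟩
  haveI : NeZero (Module.finrank (fixedField (St ψ)) L) := ⟨Module.finrank_pos.ne'⟩
  obtain ⟨m, e, hm, he⟩ := aux_abs ρ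
    (fun i : {g : L ≃ₐ[K] L // rep g = g} => fixedField (St (comp (i : L ≃ₐ[K] L))))
    Subtype.val
    (fun i => rhoHom_range _ _ (hSt (comp i)))
    (fun g => by
      have h1 : rep g = rep (rep g) := (hrep' g (rep g)).1 (hrep g)
      exact ⟨⟨rep g, h1.symm⟩, ((hker _ _).2 (hrep g)).symm⟩)
    (fun i j h => by
      apply Subtype.ext
      have := (hrep' _ _).1 ((hker _ _).1 h)
      rwa [i.2, j.2] at this)
    Θ
    (fun r t g => by
      rw [← hρ]
      exact hΘ r t g)
  have hm' : ∀ i : {g : L ≃ₐ[K] L // rep g = g}, m i * (Nat.card (St φ) * Nat.card (St ψ))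
      = Nat.card (St (comp (i : L ≃ₐ[K] L)))
        * Nat.card {g : L ≃ₐ[K] L // rel (i : L ≃ₐ[K] L) g} := by
    intro i
    have h1 := hm i
    simp only [Nat.card_prod, Nat.card_eq_fintype_card (α := Fin _), Fintype.card_fin,
      finrank_fixedField_eq_card, hker] at h1
    rw [← Module.finrank_mul_finrank K (fixedField (St (comp (i : L ≃ₐ[K] L)))) L,
      finrank_fixedField_eq_card] at h1
    have hpos : 0 < Module.finrank K (fixedField (St (comp (i : L ≃ₐ[K] L)))) :=
      Module.finrank_pos
    apply Nat.eq_of_mul_eq_mul_right hpos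
    rw [h1]
    ring
  refine ⟨m, e, ?_, ?_, ?_⟩
  · intro i
    refine ⟨?_, hm' i⟩
    have hne : Nonempty {g : L ≃ₐ[K] L // rel (i : L ≃ₐ[K] L) g} :=
      ⟨⟨i, (hker _ _).1 rfl⟩⟩
    have h2 : 0 < Nat.card (St (comp (i : L ≃ₐ[K] L)))
        * Nat.card {g : L ≃ₐ[K] L // rel (i : L ≃ₐ[K] L) g} :=
      Nat.mul_pos Nat.card_pos Nat.card_pos
    rw [← hm' i] at h2
    exact Nat.pos_of_mul_pos_right h2
  · intro c x y i j
    have h1 := he (c ⊗ₜ 1) (TwMod.mk φK x ⊗ₜ[K] y) i j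
    rw [hsm, bimodHom_tmul, map_one, one_mul] at h1
    have h2 : ρ (i : L ≃ₐ[K] L) (c ⊗ₜ 1) = algebraMap K L c := by
      simp only [ρ]
      rw [rhoHom_tmul, map_one, map_one, mul_one]
    rw [h2] at h1
    exact h1
  · intro c x y i j
    have h1 := he (1 ⊗ₜ c) (TwMod.mk φK x ⊗ₜ[K] y) i j
    rw [hsm, bimodHom_tmul, map_one, map_one, mul_comm (ψK c)] at h1
    have h2 : ρ (i : L ≃ₐ[K] L) (1 ⊗ₜ c) = comp i (algebraMap K L c) := by
      simp only [ρ]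
      rw [rhoHom_tmul, map_one, one_mul]
      rfl
    rw [h2, mul_comm (comp i (algebraMap K L c))] at h1
    exact h1
end

section
/- Let Ω be a group and G ⊆ Ω a finite subgroup. For τ ∈ Ω set H_τ := G ∩ τGτ⁻¹ and b_τ := Σ_{σ ∈ GτG} σ ∈ ℚ[Ω], the sum of the (finitely many, namely |G|²/|H_τ|) distinct elements of the double coset GτG. Then for all φ, ψ ∈ Ω the following identity holds in the group algebra ℚ[Ω]: b_φ · b_ψ = (|G| / (|H_φ|·|H_ψ|)) · Σ_{g ∈ G} |H_{φgψ}| · b_{φgψ}. (When Ω = Aut(L) for a finite Galois extension L/K with group G, H_φ coincides with the stabilizer St(φ) = {g ∈ G : gφ = φ on K}.) -/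
open Classical in
/-- The fibre of `(g₁, g₂) ↦ g₁ τ g₂` over `a τ c` has as many elements as `H_τ`. -/
lemma fibre_card {Ω : Type*} [Group Ω] (G : Subgroup Ω) [Fintype G] (τ : Ω) (a c : G) :
    (Finset.univ.filter (fun p : G × G => (p.1 : Ω) * τ * p.2 = a * τ * c)).card
      = Nat.card {g : Ω // g ∈ G ∧ τ⁻¹ * g * τ ∈ G} := by
  rw [← Fintype.card_subtype, ← Nat.card_eq_fintype_card]
  have key : ∀ p : G × G, (p.1 : Ω) * τ * p.2 = a * τ * c →
      τ⁻¹ * ((a : Ω)⁻¹ * p.1) * τ = c * (p.2 : Ω)⁻¹ := by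
    intro p hp
    rw [eq_mul_inv_iff_mul_eq]
    calc τ⁻¹ * ((a : Ω)⁻¹ * p.1) * τ * p.2 = τ⁻¹ * (a : Ω)⁻¹ * (p.1 * τ * p.2) := by group
      _ = c := by rw [hp]; group
  refine Nat.card_congr
    { toFun := fun p => ⟨(a : Ω)⁻¹ * p.1.1, G.mul_mem (G.inv_mem a.2) p.1.1.2, ?_⟩
      invFun := fun h => ⟨(⟨a * h.1, G.mul_mem a.2 h.2.1⟩,
        ⟨(τ⁻¹ * h.1 * τ)⁻¹ * c, G.mul_mem (G.inv_mem h.2.2) c.2⟩), ?_⟩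
      left_inv := ?_
      right_inv := ?_ }
  · rw [key p.1 p.2]
    exact G.mul_mem c.2 (G.inv_mem p.1.2.2)
  · simp only
    group
  · rintro ⟨p, hp⟩
    ext
    · simp
    · simp only [key p hp]
      group
  · rintro ⟨h, hh⟩
    simp

open Classical in
/-- `e τ e = |H_τ| b_τ`, where `e` is the sum of the elements of `G`. -/
lemma card_smul_b {Ω : Type*} [Group Ω] (G : Subgroup Ω) [Fintype G] (τ : Ω) :
    (Nat.card {g : Ω // g ∈ G ∧ τ⁻¹ * g * τ ∈ G} : ℚ) •
      (∑ᶠ σ ∈ {x : Ω | ∃ g₁ ∈ G, ∃ g₂ ∈ G, x = g₁ * τ * g₂},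
        MonoidAlgebra.single σ (1 : ℚ)) =
    (∑ g : G, MonoidAlgebra.single (g : Ω) (1 : ℚ)) * MonoidAlgebra.single τ 1 *
      (∑ g : G, MonoidAlgebra.single (g : Ω) (1 : ℚ)) := by
  have hset : {x : Ω | ∃ g₁ ∈ G, ∃ g₂ ∈ G, x = g₁ * τ * g₂} =
      ((Finset.univ.image (fun p : G × G => (p.1 : Ω) * τ * p.2) : Finset Ω) : Set Ω) := by
    ext x
    simp only [Set.mem_ofPred_eq, Finset.coe_image, Finset.coe_univ, Set.image_univ, Set.mem_range,
      Prod.exists, Subtype.exists]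
    constructor
    · rintro ⟨a, ha, c, hc, rfl⟩
      exact ⟨a, ha, c, hc, rfl⟩
    · rintro ⟨a, ha, c, hc, rfl⟩
      exact ⟨a, ha, c, hc, rfl⟩
  rw [hset, finsum_mem_coe_finset, Finset.sum_mul, Finset.sum_mul_sum]
  simp only [MonoidAlgebra.single_mul_single, mul_one]
  rw [← Finset.sum_product', Finset.univ_product_univ,
    Finset.sum_comp (fun x : Ω => MonoidAlgebra.single x (1 : ℚ))
      (fun p : G × G => (p.1 : Ω) * τ * p.2), Finset.smul_sum]
  refine Finset.sum_congr rfl fun x hx => ?_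
  obtain ⟨⟨a, c⟩, -, rfl⟩ := Finset.mem_image.1 hx
  rw [fibre_card G τ a c, Nat.cast_smul_eq_nsmul]

/-- Hecke-algebra identity: for a group `Ω`, a finite subgroup `G`, `H_τ := G ∩ τGτ⁻¹`
and `b_τ := Σ_{σ ∈ GτG} σ ∈ ℚ[Ω]`, one has
`b_φ · b_ψ = (|G| / (|H_φ|·|H_ψ|)) · Σ_{g ∈ G} |H_{φgψ}| · b_{φgψ}`. -/
theorem stmt11 {Ω : Type*} [Group Ω] (G : Subgroup Ω) [Finite G]
    (Hc : Ω → ℕ)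
    (hHc : ∀ τ : Ω, Hc τ = Nat.card {g : Ω // g ∈ G ∧ τ⁻¹ * g * τ ∈ G})
    (b : Ω → MonoidAlgebra ℚ Ω)
    (hb : ∀ τ : Ω, b τ =
      ∑ᶠ σ ∈ {x : Ω | ∃ g₁ ∈ G, ∃ g₂ ∈ G, x = g₁ * τ * g₂},
        MonoidAlgebra.single σ (1 : ℚ)) :
    ∀ φ ψ : Ω, b φ * b ψ =
      ((Nat.card G : ℚ) / ((Hc φ : ℚ) * (Hc ψ : ℚ))) •
        ∑ᶠ g ∈ (G : Set Ω), (Hc (φ * g * ψ) : ℚ) • b (φ * g * ψ) := by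
  classical
  intro φ ψ
  have : Fintype G := Fintype.ofFinite G
  have hpos : ∀ τ, (Hc τ : ℚ) ≠ 0 := by
    intro τ
    rw [hHc τ]
    have : Finite {g : Ω // g ∈ G ∧ τ⁻¹ * g * τ ∈ G} :=
      Finite.of_injective (fun x => (⟨x.1, x.2.1⟩ : G))
        (fun x y h => Subtype.ext (by simpa using h))
    have : Nonempty {g : Ω // g ∈ G ∧ τ⁻¹ * g * τ ∈ G} := ⟨⟨1, G.one_mem, by simp⟩⟩
    exact_mod_cast Nat.card_pos.ne'
  set e : MonoidAlgebra ℚ Ω := ∑ g : G, MonoidAlgebra.single (g : Ω) (1 : ℚ) with he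
  have hk : ∀ τ, (Hc τ : ℚ) • b τ = e * MonoidAlgebra.single τ 1 * e := by
    intro τ
    rw [hHc τ, hb τ, card_smul_b]
  have hge : ∀ g : G, MonoidAlgebra.single (g : Ω) (1 : ℚ) * e = e := by
    intro g
    rw [he, Finset.mul_sum]
    simp only [MonoidAlgebra.single_mul_single, mul_one]
    exact Fintype.sum_equiv (Equiv.mulLeft g) _ _ (fun x => by simp)
  have hee : e * e = (Nat.card G : ℚ) • e := by
    conv_lhs => rw [he, Finset.sum_mul, ← he]
    rw [Finset.sum_congr rfl (fun g _ => hge g), Finset.sum_const, Nat.cast_smul_eq_nsmul,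
      Nat.card_eq_fintype_card, Finset.card_univ]
  have hexp : ∀ X Y : MonoidAlgebra ℚ Ω, X * e * Y =
      ∑ g : G, X * MonoidAlgebra.single (g : Ω) (1 : ℚ) * Y := by
    intro X Y
    rw [he, Finset.mul_sum, Finset.sum_mul]
  have hsum : ∑ᶠ g ∈ (G : Set Ω), (Hc (φ * g * ψ) : ℚ) • b (φ * g * ψ) =
      e * MonoidAlgebra.single φ 1 * e * MonoidAlgebra.single ψ 1 * e := by
    rw [finsum_mem_eq_finite_toFinset_sum _ (Set.toFinite (G : Set Ω))]
    rw [← Finset.sum_subtype (p := fun x => x ∈ G) _ (by simp)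
      (fun g => (Hc (φ * g * ψ) : ℚ) • b (φ * g * ψ)) |>.symm]
    simp only [hk]
    rw [mul_assoc _ (MonoidAlgebra.single ψ 1) e, hexp]
    refine Finset.sum_congr rfl fun g _ => ?_
    have : MonoidAlgebra.single (φ * (g : Ω) * ψ) (1 : ℚ) = MonoidAlgebra.single φ 1 *
        MonoidAlgebra.single (g : Ω) 1 * MonoidAlgebra.single ψ 1 := by
      simp [MonoidAlgebra.single_mul_single]
    rw [this]
    simp only [mul_assoc]
  have hprod : ((Hc φ : ℚ) * (Hc ψ : ℚ)) • (b φ * b ψ) = (Nat.card G : ℚ) •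
      (e * MonoidAlgebra.single φ 1 * e * MonoidAlgebra.single ψ 1 * e) := by
    rw [← smul_mul_smul_comm, hk, hk]
    calc _ = e * MonoidAlgebra.single φ 1 * (e * e) * MonoidAlgebra.single ψ 1 * e := by
          simp only [mul_assoc]
      _ = _ := by rw [hee]; simp only [mul_smul_comm, smul_mul_assoc]
  rw [hsum, div_eq_inv_mul, mul_smul, ← hprod, smul_smul,
    inv_mul_cancel₀ (mul_ne_zero (hpos φ) (hpos ψ)), one_smul]
end

section
/- Let Γ be a commutative Noetherian integral domain, P a projective Γ-module, and M ⊆ P a finitely generated submodule. Then the saturation D(M) = {x ∈ P : γ·x ∈ M for some nonzero γ ∈ Γ} (the preimage in P of the torsion submodule of P/M) is a finitely generated Γ-module. -/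
/-- Let `Γ` be a commutative Noetherian integral domain, `P` a projective `Γ`-module and
`M ⊆ P` a finitely generated submodule.  Then the saturation
`D(M) = {x ∈ P : γ • x ∈ M for some nonzero γ}` is a finitely generated `Γ`-module. -/
theorem stmt15 {Γ P : Type*} [CommRing Γ] [IsDomain Γ] [IsNoetherianRing Γ]
    [AddCommGroup P] [Module Γ P] [Module.Projective Γ P]
    (M : Submodule Γ P) (hM : M.FG)
    (D : Submodule Γ P)
    (hD : (D : Set P) = {x : P | ∃ γ : Γ, γ ≠ 0 ∧ γ • x ∈ M}) :
    D.FG := by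
  classical
  obtain ⟨s, hs⟩ := (Module.projective_def (R := Γ) (P := P)).1 inferInstance
  obtain ⟨S, rfl⟩ := hM
  let T : Finset P := S.biUnion fun m => (s m).support
  have hMT : Submodule.span Γ (S : Set P) ≤
      (Finsupp.supported Γ Γ (T : Set P)).comap s := by
    rw [Submodule.span_le]
    intro m hm
    simp only [Submodule.comap_coe, Set.mem_preimage, SetLike.mem_coe, Finsupp.mem_supported]
    exact_mod_cast Finset.subset_biUnion_of_mem (fun m => (s m).support) hm
  have hDT : D ≤ Submodule.span Γ (T : Set P) := by
    intro x hx
    have hx' : x ∈ (D : Set P) := hx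
    rw [hD] at hx'
    obtain ⟨γ, hγ, hx'⟩ := hx'
    have h := hMT hx'
    rw [Submodule.mem_comap, map_smul, Finsupp.mem_supported,
      Finsupp.support_smul_eq hγ] at h
    rw [← hs x, Finsupp.linearCombination_apply]
    exact Submodule.sum_mem _ fun p hp =>
      Submodule.smul_mem _ _ (Submodule.subset_span (h hp))
  have : IsNoetherian Γ (Submodule.span Γ (T : Set P)) :=
    isNoetherian_of_fg_of_noetherian _ ⟨T, rfl⟩
  have : IsNoetherian Γ D := isNoetherian_of_le hDT
  exact (Submodule.fg_top D).1 (IsNoetherian.noetherian ⊤)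
end

section
/- Let G be a finite group, H ⊆ G a subgroup, F a field, and M a module over the group algebra F[H]. Consider the induced module Ind = F[G] ⊗_{F[H]} M, with G acting by left multiplication on the first factor. Then the space of G-invariants Ind^G = {x ∈ Ind : g·x = x for all g ∈ G} is isomorphic as an F-vector space to the space of H-invariants M^H = {m ∈ M : h·m = m for all h ∈ H}. -/
open TensorProduct

theorem ind_ext {F G : Type*} [Field F] [Group G] {M : Type*} [AddCommGroup M] [Module F M]
    {P : Type*} [AddCommGroup P] [Module F P]
    {f g : (MonoidAlgebra F G ⊗[F] M) →ₗ[F] P}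
    (h : ∀ (a : G) (m : M), f (MonoidAlgebra.single a (1 : F) ⊗ₜ[F] m)
      = g (MonoidAlgebra.single a (1 : F) ⊗ₜ[F] m)) : f = g := by
  apply TensorProduct.ext'
  intro x m
  induction x using MonoidAlgebra.induction_linear with
  | zero => simp
  | add x y hx hy => simp only [TensorProduct.add_tmul, map_add, hx, hy]
  | single a r =>
    have : (MonoidAlgebra.single a r : MonoidAlgebra F G) = r • MonoidAlgebra.single a (1 : F) := by
      simp
    rw [this, ← TensorProduct.smul_tmul', map_smul, map_smul, h]

/-- Frobenius reciprocity for invariants: let `G` be a finite group, `H ≤ G`, `F` a field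
and `M` an `F[H]`-module.  Realize the induced module `Ind = F[G] ⊗_{F[H]} M` as the
quotient of `F[G] ⊗_F M` by the relations `(x·h) ⊗ m = x ⊗ (h·m)`, with `G` acting by
left multiplication on the first factor.  Then `Ind^G ≅ M^H` as `F`-vector spaces. -/
theorem stmt17 {F G : Type*} [Field F] [Group G] [Finite G] (H : Subgroup G)
    (M : Type*) [AddCommGroup M] [Module F M]
    [Module (MonoidAlgebra F H) M] [IsScalarTower F (MonoidAlgebra F H) M]
    (N : Submodule F (MonoidAlgebra F G ⊗[F] M))
    (hN : N = Submodule.span F {t : MonoidAlgebra F G ⊗[F] M |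
      ∃ (x : MonoidAlgebra F G) (h : H) (m : M),
        t = (x * MonoidAlgebra.single (h : G) (1 : F)) ⊗ₜ[F] m
          - x ⊗ₜ[F] ((MonoidAlgebra.single h (1 : F) : MonoidAlgebra F H) • m)})
    (act : G → ((MonoidAlgebra F G ⊗[F] M) ⧸ N) →ₗ[F] ((MonoidAlgebra F G ⊗[F] M) ⧸ N))
    (hact : ∀ (g : G) (t : MonoidAlgebra F G ⊗[F] M),
      act g (Submodule.Quotient.mk t) = Submodule.Quotient.mk
        (LinearMap.rTensor M
          (LinearMap.mulLeft F (MonoidAlgebra.single g (1 : F))) t))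
    (S : Submodule F ((MonoidAlgebra F G ⊗[F] M) ⧸ N))
    (hS : ∀ y, y ∈ S ↔ ∀ g : G, act g y = y)
    (S' : Submodule F M)
    (hS' : ∀ m : M, m ∈ S' ↔
      ∀ h : H, (MonoidAlgebra.single h (1 : F) : MonoidAlgebra F H) • m = m) :
    Nonempty (S ≃ₗ[F] S') := by
  classical
  have : SMulCommClass (MonoidAlgebra F H) F M := inferInstance
  have : Fintype (G ⧸ H) := Fintype.ofFinite _
  let ρ : H → M →ₗ[F] M := fun h =>
    DistribSMul.toLinearMap F M (MonoidAlgebra.single h (1 : F) : MonoidAlgebra F H)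
  have hρ : ∀ h m, (MonoidAlgebra.single h (1 : F) : MonoidAlgebra F H) • m = ρ h m :=
    fun h m => rfl
  have ρ_mul : ∀ h k m, ρ (h * k) m = ρ h (ρ k m) := by
    intro h k m
    rw [← hρ, ← hρ, ← hρ, smul_smul, MonoidAlgebra.single_mul_single, one_mul]
  simp only [hρ] at hN hS'
  clear_value ρ
  let L : G → M →ₗ[F] M := fun g => if hg : g ∈ H then ρ ⟨g, hg⟩ else 0
  have L_mem : ∀ (h : H), L h = ρ h := fun h => by simp [L]
  have L_not : ∀ g, g ∉ H → L g = 0 := fun g hg => by simp [L, hg]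
  have L_mulr : ∀ g (h : H) m, L (g * h) m = L g (ρ h m) := by
    intro g h m
    by_cases hg : g ∈ H
    · lift g to H using hg
      rw [← Subgroup.coe_mul, L_mem, L_mem, ρ_mul]
    · rw [L_not g hg, L_not (g * h) (by rwa [H.mul_mem_cancel_right h.2])]
      simp
  have L_mull : ∀ g (h : H) m, L (h * g) m = ρ h (L g m) := by
    intro g h m
    by_cases hg : g ∈ H
    · lift g to H using hg
      rw [← Subgroup.coe_mul, L_mem, L_mem, ρ_mul]
    · rw [L_not g hg, L_not (h * g) (by rwa [H.mul_mem_cancel_left h.2])]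
      simp
  clear_value L
  let E₀ : (MonoidAlgebra F G ⊗[F] M) →ₗ[F] M :=
    TensorProduct.lift ((Finsupp.linearCombination F L) ∘ₗ
      (MonoidAlgebra.coeffLinearEquiv F).toLinearMap)
  have E₀_single : ∀ g m, E₀ (MonoidAlgebra.single g (1 : F) ⊗ₜ[F] m) = L g m := by
    intro g m
    simp [E₀, MonoidAlgebra.coeffLinearEquiv]
  clear_value E₀
  have E₀_N : N ≤ LinearMap.ker E₀ := by
    rw [hN, Submodule.span_le]
    rintro _ ⟨x, h, m, rfl⟩
    rw [SetLike.mem_coe, LinearMap.mem_ker, map_sub, sub_eq_zero]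
    have key : E₀ ∘ₗ LinearMap.rTensor M
          (LinearMap.mulRight F (MonoidAlgebra.single (h : G) (1 : F)))
        = E₀ ∘ₗ LinearMap.lTensor (MonoidAlgebra F G) (ρ h) := by
      apply ind_ext
      intro a m
      simp [MonoidAlgebra.single_mul_single, E₀_single, L_mulr]
    simpa using LinearMap.congr_fun key (x ⊗ₜ[F] m)
  let E : ((MonoidAlgebra F G ⊗[F] M) ⧸ N) →ₗ[F] M := N.liftQ E₀ E₀_N
  let c : G → M →ₗ[F] ((MonoidAlgebra F G ⊗[F] M) ⧸ N) := fun g =>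
    N.mkQ ∘ₗ TensorProduct.mk F _ M (MonoidAlgebra.single g (1 : F))
  have c_mul : ∀ g (h : H) m, c (g * h) m = c g (ρ h m) := by
    intro g h m
    refine (Submodule.Quotient.eq N).2 ?_
    rw [hN]
    refine Submodule.subset_span ⟨MonoidAlgebra.single g 1, h, m, ?_⟩
    simp [MonoidAlgebra.single_mul_single]
  have E_c : ∀ g m, E (c g m) = L g m := fun g m => E₀_single g m
  have act_c : ∀ a g m, act a (c g m) = c (a * g) m := by
    intro a g m
    refine (hact a _).trans ?_
    simp [c, MonoidAlgebra.single_mul_single]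
  have ext : ∀ (P : Type _) [AddCommGroup P] [Module F P]
      (f g : ((MonoidAlgebra F G ⊗[F] M) ⧸ N) →ₗ[F] P),
      (∀ a m, f (c a m) = g (c a m)) → f = g := by
    intro P _ _ f g h
    apply Submodule.linearMap_qext
    apply ind_ext
    exact h
  have ext' : ∀ (f g : ((MonoidAlgebra F G ⊗[F] M) ⧸ N) →ₗ[F] M),
      (∀ a m, f (c a m) = g (c a m)) → f = g := by
    intro f g h
    apply Submodule.linearMap_qext
    apply ind_ext
    exact h
  clear_value E c
  have E_act : ∀ (h : H) y, E (act h y) = ρ h (E y) := by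
    intro h
    refine LinearMap.congr_fun (f := E ∘ₗ act h) (g := ρ h ∘ₗ E) (ext' _ _ ?_)
    intro a m
    simp [act_c, E_c, L_mull]
  have recon : ∀ y, ∑ q : G ⧸ H, c q.out (E (act q.out⁻¹ y)) = y := by
    intro y
    have := LinearMap.congr_fun (f := ∑ q : G ⧸ H, c q.out ∘ₗ E ∘ₗ act q.out⁻¹)
      (g := LinearMap.id) (ext _ _ _ ?_) y
    · simpa using this
    intro a m
    simp only [LinearMap.sum_apply, LinearMap.comp_apply, act_c, E_c, LinearMap.id_apply]
    rw [Finset.sum_eq_single (a : G ⧸ H)]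
    · have hm : (a : G ⧸ H).out⁻¹ * a ∈ H := by
        rw [← QuotientGroup.eq, QuotientGroup.out_eq']
      have := L_mem ⟨_, hm⟩
      simp only at this
      rw [this, ← c_mul]
      simp
    · intro q _ hq
      rw [L_not, LinearMap.zero_apply, map_zero]
      rw [← QuotientGroup.eq, QuotientGroup.out_eq']
      exact hq
    · simp
  have E_S : ∀ y ∈ S, E y ∈ S' := by
    intro y hy
    rw [hS']
    intro h
    rw [← E_act, (hS y).1 hy]
  refine ⟨LinearEquiv.ofBijective (E.restrict E_S) ⟨?_, ?_⟩⟩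
  · rw [injective_iff_map_eq_zero]
    rintro ⟨y, hy⟩ h0
    have h0 : E y = 0 := congrArg Subtype.val h0
    ext
    change y = 0
    rw [← recon y]
    refine Finset.sum_eq_zero fun q _ => ?_
    rw [(hS y).1 hy, h0, map_zero]
  · rintro ⟨m, hm⟩
    have hm' := (hS' m).1 hm
    have c_out : ∀ g : G, c (g : G ⧸ H).out m = c g m := by
      intro g
      have hmem : g⁻¹ * (g : G ⧸ H).out ∈ H := by
        rw [← QuotientGroup.eq, QuotientGroup.out_eq']
      have := c_mul g ⟨_, hmem⟩ m
      rw [hm'] at this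
      simpa using this
    refine ⟨⟨∑ q : G ⧸ H, c q.out m, ?_⟩, ?_⟩
    · rw [hS]
      intro g
      rw [map_sum]
      refine Fintype.sum_equiv (MulAction.toPerm g) _ _ fun q => ?_
      rw [act_c, ← c_out]
      have : ((g * q.out : G) : G ⧸ H) = g • q := by
        conv_rhs => rw [← QuotientGroup.out_eq' q]
        rfl
      rw [this]
      rfl
    · ext
      change E (∑ q : G ⧸ H, c q.out m) = m
      rw [map_sum, Finset.sum_eq_single ((1 : G) : G ⧸ H)]
      · rw [c_out, E_c]
        have := L_mem 1
        rw [Subgroup.coe_one] at this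
        rw [this, hm']
      · intro q _ hq
        rw [E_c, L_not, LinearMap.zero_apply]
        intro h
        apply hq
        rw [← QuotientGroup.out_eq' q, eq_comm, QuotientGroup.eq]
        simpa using h
      · simp
end

section
/- Let k be a field, and let K ⊆ L be a finite Galois extension of field extensions of k with Galois group G acting by k-algebra automorphisms. Let V be a k-central K-bimodule (a module over K ⊗_k K) that is simple as a K-bimodule and finite-dimensional over K. Equip W := L ⊗_K V (formed using the left K-action on V) with: multiplication by L on the left tensor factor, the G-action g·(l ⊗ v) = g(l) ⊗ v, and the right K-action (l ⊗ v)·c = l ⊗ (v·c). Then W is simple for these combined actions: the only additive subgroups of W stable under multiplication by L, under the G-action, and under the right K-action are 0 and W. -/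
open TensorProduct

/-- Let `K ⊆ L` be a finite Galois extension of field extensions of `k` with Galois group
`G = Gal(L/K)`, and let `V` be a `k`-central `K`-bimodule (a module over `K ⊗_k K`) which is
simple and finite-dimensional over `K` (for its left action).  Then `W = L ⊗_K V`, with `L`
acting by multiplication on the left factor, `G` acting on the left factor, and `K` acting
on the right of `V`, is simple: the only additive subgroups stable under all three actions
are `0` and `W`. -/
theorem stmt18 {k K L : Type*} [Field k] [Field K] [Field L]
    [Algebra k K] [Algebra k L] [Algebra K L] [IsScalarTower k K L]
    [FiniteDimensional K L] [IsGalois K L]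
    (V : Type*) [AddCommGroup V] [Module (K ⊗[k] K) V] [Nontrivial V]
    [Module K V] (hKV : ∀ (c : K) (v : V), c • v = ((c ⊗ₜ[k] (1 : K)) : K ⊗[k] K) • v)
    [FiniteDimensional K V]
    (hsimple : ∀ N : Submodule (K ⊗[k] K) V, N = ⊥ ∨ N = ⊤)
    (ρ : K → V →ₗ[K] V)
    (hρ : ∀ (c : K) (v : V), ρ c v = (((1 : K) ⊗ₜ[k] c) : K ⊗[k] K) • v) :
    ∀ W' : AddSubgroup (L ⊗[K] V),
      (∀ (l : L), ∀ x ∈ W', l • x ∈ W') →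
      (∀ (g : L ≃ₐ[K] L), ∀ x ∈ W', LinearMap.rTensor V g.toLinearMap x ∈ W') →
      (∀ (c : K), ∀ x ∈ W', LinearMap.lTensor L (ρ c) x ∈ W') →
      W' = ⊥ ∨ W' = ⊤ := by
  intro W' hL hG hR
  classical
  let N : Submodule (K ⊗[k] K) V :=
    { carrier := {v | (1 : L) ⊗ₜ[K] v ∈ W'}
      add_mem' := by
        intro a b ha hb
        simp only [Set.mem_ofPred_eq, TensorProduct.tmul_add] at *
        exact W'.add_mem ha hb
      zero_mem' := by
        simp only [Set.mem_ofPred_eq, TensorProduct.tmul_zero]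
        exact W'.zero_mem
      smul_mem' := by
        intro r v hv
        simp only [Set.mem_ofPred_eq] at *
        induction r using TensorProduct.induction_on with
        | zero => simp only [zero_smul, TensorProduct.tmul_zero]; exact W'.zero_mem
        | add x y hx hy =>
          rw [add_smul, TensorProduct.tmul_add]; exact W'.add_mem hx hy
        | tmul a b =>
          have h1 : (a ⊗ₜ[k] b : K ⊗[k] K) • v = a • ρ b v := by
            rw [hKV, hρ, ← mul_smul]; simp
          have h2 := hL (algebraMap K L a) _ (hR b _ hv)
          rw [h1, ← TensorProduct.smul_tmul]
          simpa [TensorProduct.smul_tmul', Algebra.smul_def] using h2 }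
  have memN : ∀ v, v ∈ N ↔ (1 : L) ⊗ₜ[K] v ∈ W' := fun v => Iff.rfl
  let T : L ⊗[K] V →ₗ[K] V :=
    (TensorProduct.lid K V).toLinearMap ∘ₗ LinearMap.rTensor V (Algebra.trace K L)
  have hT : ∀ x, (1 : L) ⊗ₜ[K] T x =
      ∑ g : L ≃ₐ[K] L, LinearMap.rTensor V g.toLinearMap x := by
    intro x
    induction x using TensorProduct.induction_on with
    | zero => simp
    | add x y hx hy =>
      simp only [map_add, TensorProduct.tmul_add, Finset.sum_add_distrib, hx, hy]
    | tmul l v =>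
      have : T (l ⊗ₜ v) = Algebra.trace K L l • v := by simp [T]
      rw [this, ← TensorProduct.smul_tmul, ← Algebra.algebraMap_eq_smul_one,
        trace_eq_sum_automorphisms, TensorProduct.sum_tmul]
      simp
  have hTmem : ∀ x ∈ W', T x ∈ N := by
    intro x hx
    rw [memN, hT]
    exact W'.sum_mem fun g _ => hG g x hx
  let b := Module.finBasis K L
  let d := (Algebra.traceForm K L).dualBasis (traceForm_nondegenerate K L) b
  have hx : ∀ x : L ⊗[K] V, x = ∑ i, d i • ((1 : L) ⊗ₜ[K] T (b i • x)) := by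
    intro x
    induction x using TensorProduct.induction_on with
    | zero => simp
    | add x y hx hy =>
      simp only [map_add, smul_add, TensorProduct.tmul_add, Finset.sum_add_distrib]
      rw [← hx, ← hy]
    | tmul l v =>
      have h1 : ∀ i, T (b i • (l ⊗ₜ v)) = d.repr l i • v := by
        intro i
        rw [LinearMap.BilinForm.dualBasis_repr_apply]
        simp [T, TensorProduct.smul_tmul', Algebra.traceForm_apply, mul_comm]
      simp only [h1]
      simp only [TensorProduct.smul_tmul', smul_eq_mul, mul_one]
      simp only [← TensorProduct.smul_tmul]
      rw [← TensorProduct.sum_tmul, d.sum_repr]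
  rcases hsimple N with h | h
  · left
    rw [AddSubgroup.eq_bot_iff_forall]
    intro x hxW
    rw [hx x]
    refine Finset.sum_eq_zero fun i _ => ?_
    have := hTmem _ (hL (b i) x hxW)
    rw [h, Submodule.mem_bot] at this
    rw [this]; simp
  · right
    rw [AddSubgroup.eq_top_iff']
    intro x
    rw [hx x]
    refine W'.sum_mem fun i _ => hL _ _ ?_
    rw [← memN, h]; trivial
end
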